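/- arXiv:2402.01072 — 4 statements merged into one kernel-verified Lean document; each statement's English description precedes it below -/
import Mathlib

section
/- Let G be a finite group with a normal subgroup N such that G/N is p-nilpotent, where p is a prime. Suppose every subgroup of N of order p is contained in the center Z(G), and (if p = 2) every cyclic subgroup of N of order 4 is weakly SΦ-supplemented in G. Then G is p-nilpotent. -/
open scoped Pointwise

/-- A subgroup `A` is S-permutable in `G` if it permutes with every Sylow subgroup of `G`. -/
def IsSPermutable {G : Type*} [Group G] (A : Subgroup G) : Prop :=
  ∀ (p : ℕ), p.Prime → ∀ Q : Sylow p G,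
    (A : Set G) * ((Q : Subgroup G) : Set G) = ((Q : Subgroup G) : Set G) * (A : Set G)

/-- `A_{sG}`: the subgroup generated by all subgroups of `A` that are S-permutable in `G`. -/
def sCore {G : Type*} [Group G] (A : Subgroup G) : Subgroup G :=
  ⨆ B ∈ {B : Subgroup G | B ≤ A ∧ IsSPermutable B}, B

/-- `A` is weakly SΦ-supplemented in `G` if there is `T ≤ G` with `G = AT` and
`A ∩ T ≤ Φ(A) · A_{sG}`. -/
def WeaklySPhiSupplemented {G : Type*} [Group G] (A : Subgroup G) : Prop :=
  ∃ T : Subgroup G, (A : Set G) * (T : Set G) = Set.univ ∧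
    A ⊓ T ≤ (frattini A).map A.subtype ⊔ sCore A

/-- `G` is `p`-nilpotent: it has a normal `p`-complement. -/
def IsPNilpotent (p : ℕ) (G : Type*) [Group G] : Prop :=
  ∃ H : Subgroup G, H.Normal ∧ (∃ n : ℕ, H.index = p ^ n) ∧ ¬ p ∣ Nat.card H

/-- A group is supersolvable if it has a normal series with cyclic factors. -/
def IsSupersolvable (G : Type*) [Group G] : Prop :=
  ∃ (n : ℕ) (s : Fin (n + 1) → Subgroup G),
    s 0 = ⊥ ∧ s (Fin.last n) = ⊤ ∧ Monotone s ∧ (∀ i, (s i).Normal) ∧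
    ∀ i : Fin n, ∃ x : G, s i.succ ≤ s i.castSucc ⊔ Subgroup.zpowers x

/-- `H/K` is a chief factor of `G`. -/
def IsChiefFactor {G : Type*} [Group G] (K H : Subgroup G) : Prop :=
  K.Normal ∧ H.Normal ∧ K < H ∧
    ∀ L : Subgroup G, L.Normal → K ≤ L → L ≤ H → L = K ∨ L = H

/-- A quasisimple group: perfect, and simple modulo its center. -/
def IsQuasisimple (G : Type*) [Group G] : Prop :=
  commutator G = ⊤ ∧ IsSimpleGroup (G ⧸ Subgroup.center G)

/-- A subgroup is subnormal if there is an ascending chain of successively normal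
subgroups reaching `⊤`. -/
def IsSubnormalSubgroup {G : Type*} [Group G] (H : Subgroup G) : Prop :=
  ∃ (n : ℕ) (s : Fin (n + 1) → Subgroup G), s 0 = H ∧ s (Fin.last n) = ⊤ ∧
    ∀ i : Fin n, s i.castSucc ≤ s i.succ ∧ ((s i.castSucc).subgroupOf (s i.succ)).Normal

/-- The layer `E(G)`: the subgroup generated by all components of `G`. -/
def layer (G : Type*) [Group G] : Subgroup G :=
  ⨆ C ∈ {C : Subgroup G | IsSubnormalSubgroup C ∧ IsQuasisimple C}, C

/-- The Fitting subgroup `F(G)`: generated by all nilpotent normal subgroups. -/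
def fittingSubgroup (G : Type*) [Group G] : Subgroup G :=
  ⨆ H ∈ {H : Subgroup G | H.Normal ∧ Group.IsNilpotent H}, H

/-- The generalized Fitting subgroup `F*(G) = E(G) F(G)`. -/
def genFitting (G : Type*) [Group G] : Subgroup G :=
  layer G ⊔ fittingSubgroup G

section Aux
universe u

open scoped commutatorElement

theorem aux_coprime {G : Type*} [Group G] (g d e : G) (h : g * d * g⁻¹ = d * e)
    (hc : Commute g e) (hco : (orderOf g).Coprime (orderOf e)) : e = 1 := by
  have key : ∀ n : ℕ, g ^ n * d * (g ^ n)⁻¹ = d * e ^ n := by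
    intro n
    induction n with
    | zero => simp
    | succ n ih =>
      have h1 : g ^ (n+1) * d * (g ^ (n+1))⁻¹ = g * (g ^ n * d * (g ^ n)⁻¹) * g⁻¹ := by
        rw [pow_succ']; group
      rw [h1, ih]
      have h2 : g * e ^ n * g⁻¹ = e ^ n := by
        rw [(hc.pow_right n).eq]; group
      calc g * (d * e ^ n) * g⁻¹ = (g * d * g⁻¹) * (g * e ^ n * g⁻¹) := by group
        _ = d * e ^ (n+1) := by rw [h, h2, pow_succ']; group
  have h3 := key (orderOf g)
  rw [pow_orderOf_eq_one] at h3
  simp only [one_mul, inv_one, mul_one] at h3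
  have h4 : e ^ orderOf g = 1 := by
    have := h3; exact (mul_eq_left.mp this.symm)
  have h5 := orderOf_dvd_of_pow_eq_one h4
  exact orderOf_eq_one_iff.mp (Nat.eq_one_of_dvd_coprimes hco h5 dvd_rfl)

theorem aux_pow {G : Type*} [Group G] (x c z : G) (hz : c * x = z * x * c)
    (hzx : Commute z x) (hzc : Commute z c) (n : ℕ) :
    (x * c) ^ n = x ^ n * c ^ n * z ^ (n * (n - 1) / 2) := by
  have h1 : ∀ n : ℕ, c ^ n * x = x * c ^ n * z ^ n := by
    intro n
    induction n with
    | zero => simp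
    | succ n ih =>
      calc c ^ (n+1) * x = c ^ n * (c * x) := by rw [pow_succ]; group
        _ = (c ^ n * x) * z * c := by rw [hz, hzx.eq]; simp only [mul_assoc, hzc.eq]
        _ = x * c ^ n * (z ^ (n+1) * c) := by rw [ih, pow_succ]; group
        _ = _ := by rw [(hzc.pow_left (n+1)).eq, pow_succ c]; group
  induction n with
  | zero => simp
  | succ n ih =>
    rw [Nat.triangle_succ, pow_succ, ih]
    have e1 := (hzx.pow_left (n * (n - 1) / 2)).eq
    have e2 := (hzc.pow_left (n * (n - 1) / 2)).eq
    calc x ^ n * c ^ n * z ^ (n * (n - 1) / 2) * (x * c)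
        = x ^ n * c ^ n * (z ^ (n * (n - 1) / 2) * x) * c := by group
      _ = x ^ n * (c ^ n * x) * (z ^ (n * (n - 1) / 2) * c) := by rw [e1]; group
      _ = x ^ n * x * c ^ n * (z ^ n * c) * z ^ (n * (n - 1) / 2) := by rw [h1, e2]; group
      _ = x ^ (n+1) * c ^ (n+1) * (z ^ n * z ^ (n * (n - 1) / 2)) := by
        rw [(hzc.pow_left n).eq, pow_succ, pow_succ]; group
      _ = _ := by rw [← pow_add, add_comm n (n * (n - 1) / 2)]

theorem aux_commpow {G : Type*} [Group G] (x c z : G) (hz : c * x = z * x * c)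
    (hzc : Commute z c) (n : ℕ) : c ^ n * x = z ^ n * x * c ^ n := by
  induction n with
  | zero => simp
  | succ n ih =>
    calc c ^ (n+1) * x = c ^ n * (c * x) := by rw [pow_succ]; group
      _ = c ^ n * z * x * c := by rw [hz]; group
      _ = z * (c ^ n * x) * c := by rw [← (hzc.pow_right n).eq]; group
      _ = _ := by rw [ih, pow_succ' z, pow_succ c]; group

theorem aux_max {E : Type*} [Group E] [Finite E] [Nontrivial E] (p : ℕ) [hp : Fact p.Prime]
    (hE : IsPGroup p E) : ∃ M : Subgroup E, M ≠ ⊤ ∧ (∀ x, x ^ p ∈ M) ∧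
      ∀ x y : E, x * y * x⁻¹ * y⁻¹ ∈ M := by
  obtain ⟨n, hn⟩ := hE.exists_card_eq
  have hn0 : n ≠ 0 := by
    rintro rfl
    have := Finite.one_lt_card (α := E)
    rw [hn, pow_zero] at this
    exact lt_irrefl _ this
  obtain ⟨m, rfl⟩ := Nat.exists_eq_succ_of_ne_zero hn0
  obtain ⟨M, hM⟩ := Sylow.exists_subgroup_card_pow_prime (G := E) p (n := m)
    (by rw [hn]; exact pow_dvd_pow _ (Nat.le_succ m))
  have hidx : M.index = p := by
    have := M.card_mul_index
    rw [hM, hn, pow_succ] at this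
    exact Nat.eq_of_mul_eq_mul_left (pow_pos hp.out.pos m) this
  have hN : M.Normal := by
    apply Subgroup.normal_of_index_eq_minFac_card
    rw [hidx, hn, Nat.Prime.pow_minFac hp.out (Nat.succ_ne_zero m)]
  have hcard : Nat.card (E ⧸ M) = p := hidx
  have hcyc : IsCyclic (E ⧸ M) := isCyclic_of_prime_card hcard
  refine ⟨M, ?_, ?_, ?_⟩
  · rintro rfl
    rw [Subgroup.index_top] at hidx
    exact hp.out.one_lt.ne hidx
  · intro x
    rw [← QuotientGroup.eq_one_iff, QuotientGroup.mk_pow, ← hcard, pow_card_eq_one']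
  · intro x y
    rw [← QuotientGroup.eq_one_iff]
    have := (IsCyclic.isMulCommutative (α := E ⧸ M)).is_comm.comm (x : E ⧸ M) y
    simp only [QuotientGroup.mk_mul, QuotientGroup.mk_inv, this]
    group

/-- coprime action theorem -/
theorem aux_omega {G : Type*} [Group G] [Finite G] (p : ℕ) [hp : Fact p.Prime] (g : G)
    (hg : (orderOf g).Coprime p) (m : ℕ) (hpm : p ∣ m) (hm2 : p ∣ m * (m - 1) / 2) :
    ∀ n : ℕ, ∀ E : Subgroup G, Nat.card E = n → IsPGroup p E → (∀ x ∈ E, g * x * g⁻¹ ∈ E) →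
    (∀ x ∈ E, (x⁻¹ * (g * x * g⁻¹)) ^ m = 1 → Commute g (x⁻¹ * (g * x * g⁻¹))) →
    ∀ x ∈ E, Commute g x := by
  intro n
  induction n using Nat.strong_induction_on with
  | _ n IH =>
  intro E hcard hE hinv hcom
  -- the commutator elements
  have hcE : ∀ x ∈ E, x⁻¹ * (g * x * g⁻¹) ∈ E := fun x hx => E.mul_mem (E.inv_mem hx) (hinv x hx)
  have red : ∀ x ∈ E, Commute g (x⁻¹ * (g * x * g⁻¹)) → Commute g x := by
    intro x hx hc
    have h1 : x⁻¹ * (g * x * g⁻¹) = 1 := by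
      apply aux_coprime g x _ (by group) hc
      obtain ⟨k, hk⟩ := (IsPGroup.iff_orderOf.mp hE) ⟨_, hcE x hx⟩
      rw [Subgroup.orderOf_mk] at hk
      rw [hk]
      exact hg.pow_right k
    have h2 : x = g * x * g⁻¹ := inv_mul_eq_one.mp h1
    have h3 : x * g = g * x := by
      conv_lhs => rw [h2]
      group
    exact h3.symm
  -- proper invariant subgroups are centralised
  have prop : ∀ H : Subgroup G, H < E → (∀ x ∈ H, g * x * g⁻¹ ∈ H) → ∀ x ∈ H, Commute g x := by
    intro H hlt hi
    refine IH (Nat.card H) ?_ H rfl (hE.to_le hlt.le) hi (fun x hx => hcom x (hlt.le hx))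
    rw [← hcard]
    exact Set.ncard_lt_ncard hlt (Set.toFinite _)
  by_cases hbot : E = ⊥
  · subst hbot
    intro x hx
    rw [Subgroup.mem_bot] at hx
    subst hx
    exact Commute.one_right g
  have hnt : Nontrivial E := (Subgroup.nontrivial_iff_ne_bot E).mpr hbot
  obtain ⟨M, hM, hMp, hMc⟩ := aux_max p hE
  set S : Set G := {z | ∃ x ∈ E, ∃ y ∈ E, z = x ^ p ∨ z = x * y * x⁻¹ * y⁻¹} with hS
  set F : Subgroup G := Subgroup.closure S with hF
  have hFM : F ≤ M.map E.subtype := by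
    rw [hF, Subgroup.closure_le]
    rintro z ⟨x, hx, y, hy, rfl | rfl⟩
    · exact ⟨_, hMp ⟨x, hx⟩, rfl⟩
    · exact ⟨_, hMc ⟨x, hx⟩ ⟨y, hy⟩, rfl⟩
  have hFlt : F < E := by
    refine lt_of_le_of_lt hFM ?_
    refine lt_of_le_of_ne (Subgroup.map_subtype_le M) ?_
    intro h
    apply hM
    rw [eq_top_iff]
    rintro ⟨x, hx⟩ -
    rw [← h] at hx
    obtain ⟨y, hy, rfl⟩ := hx
    exact hy
  have hconj : ∀ u : G, (∀ x ∈ E, u * x * u⁻¹ ∈ E) → ∀ x ∈ F, u * x * u⁻¹ ∈ F := by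
    intro u hu x hx
    have : F ≤ F.comap (MulAut.conj u).toMonoidHom := by
      rw [hF, Subgroup.closure_le]
      rintro z ⟨x, hx, y, hy, rfl | rfl⟩
      · exact Subgroup.subset_closure ⟨u * x * u⁻¹, hu x hx, 1, E.one_mem, Or.inl (by simp)⟩
      · refine Subgroup.subset_closure ⟨u * x * u⁻¹, hu x hx, u * y * u⁻¹, hu y hy, Or.inr ?_⟩
        simp [mul_assoc]
    simpa using this hx
  have hFg : ∀ x ∈ F, Commute g x := prop F hFlt (hconj g hinv)
  have hFgc : ∀ y ∈ F, g * y * g⁻¹ = y := fun y hy => by rw [(hFg y hy).eq]; group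
  have hcF : ∀ x ∈ E, ∀ y ∈ F, y * (x⁻¹ * (g * x * g⁻¹)) = (x⁻¹ * (g * x * g⁻¹)) * y := by
    intro x hx y hy
    have h1 : x * y * x⁻¹ ∈ F := hconj x (fun z hz => E.mul_mem (E.mul_mem hx hz) (E.inv_mem hx)) y hy
    have h2 := hFgc _ h1
    have h3 : g * y = y * g := (hFg y hy).eq
    have h4 : g⁻¹ * y = y * g⁻¹ := by rw [inv_mul_eq_iff_eq_mul, ← mul_assoc, h3]; group
    have h5 : (g * x * g⁻¹) * y = (x * y * x⁻¹) * (g * x * g⁻¹) := by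
      conv_rhs => rw [← h2]
      calc (g * x * g⁻¹) * y = g * x * (g⁻¹ * y) := by group
        _ = _ := by rw [h4]; group
    calc y * (x⁻¹ * (g * x * g⁻¹)) = x⁻¹ * ((x * y * x⁻¹) * (g * x * g⁻¹)) := by group
      _ = _ := by rw [← h5]; group
  -- centraliser of F in E
  set Z : Subgroup G := E ⊓ Subgroup.centralizer (F : Set G) with hZ
  have hcZ : ∀ x ∈ E, x⁻¹ * (g * x * g⁻¹) ∈ Z := fun x hx =>
    Subgroup.mem_inf.mpr ⟨hcE x hx, Subgroup.mem_centralizer_iff.mpr (hcF x hx)⟩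
  intro x hx
  apply red x hx
  by_cases hZE : Z = E
  · apply hcom x hx
    set c := x⁻¹ * (g * x * g⁻¹) with hc
    have hcen : ∀ y ∈ F, ∀ w ∈ E, Commute y w := by
      intro y hy w hw
      rw [← hZE] at hw
      exact Subgroup.mem_centralizer_iff.mp (Subgroup.mem_inf.mp hw).2 y hy
    have hcin : c ∈ E := hcE x hx
    set z := c * x * c⁻¹ * x⁻¹ with hz
    have hzF : z ∈ F := Subgroup.subset_closure ⟨c, hcin, x, hx, Or.inr rfl⟩
    have hz0 : c * x = z * x * c := by rw [hz]; group
    have hzx := hcen z hzF x hx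
    have hzc := hcen z hzF c hcin
    have hpF : ∀ w ∈ E, w ^ p ∈ F := fun w hw =>
      Subgroup.subset_closure ⟨w, hw, 1, E.one_mem, Or.inl rfl⟩
    have hzp : z ^ p = 1 := by
      have h1 := aux_commpow x c z hz0 hzc p
      rw [(hcen _ (hpF c hcin) x hx).eq, mul_assoc] at h1
      exact (right_eq_mul.mp h1)
    have h2 := aux_pow x c z hz0 hzx hzc m
    have h3 : z ^ (m * (m - 1) / 2) = 1 := by
      obtain ⟨k, hk⟩ := hm2
      rw [hk, pow_mul, hzp, one_pow]
    have h4 : x * c = g * x * g⁻¹ := by rw [hc]; group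
    have h5 : (x * c) ^ m = x ^ m := by
      rw [h4, conj_pow]
      apply hFgc
      obtain ⟨k, hk⟩ := hpm
      rw [hk, pow_mul]
      exact F.pow_mem (hpF x hx) k
    rw [h3, mul_one, h5] at h2
    exact (left_eq_mul.mp h2)
  · apply prop Z (lt_of_le_of_ne inf_le_left hZE) ?_ _ (hcZ x hx)
    intro w hw
    obtain ⟨hw1, hw2⟩ := Subgroup.mem_inf.mp hw
    refine Subgroup.mem_inf.mpr ⟨hinv w hw1, Subgroup.mem_centralizer_iff.mpr ?_⟩
    intro y hy
    have h6 := Subgroup.mem_centralizer_iff.mp hw2 y hy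
    have h7 := hFgc y hy
    calc y * (g * w * g⁻¹) = (g * y * g⁻¹) * (g * w * g⁻¹) := by rw [h7]
      _ = g * (y * w) * g⁻¹ := by group
      _ = (g * w * g⁻¹) * (g * y * g⁻¹) := by rw [h6]; group
      _ = _ := by rw [h7]

/-- The Frobenius condition. -/
def FrobCond (p : ℕ) (G : Type*) [Group G] : Prop :=
  ∀ D : Subgroup G, IsPGroup p D → ∀ q : ℕ, q.Prime → q ≠ p → ∀ g : G,
    (∀ x, x ∈ D ↔ g * x * g⁻¹ ∈ D) → (∃ k, g ^ (q ^ k) = 1) → ∀ x ∈ D, x * g = g * x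

theorem frob_decomp {G : Type*} [Group G] [Finite G] (p : ℕ) [hp : Fact p.Prime]
    (h : FrobCond p G) (D : Subgroup G) (hD : IsPGroup p D)
    (L : Subgroup G) (hL : L = Subgroup.normalizer (D : Set G))
    (A : Sylow p L) (l : L) :
    ∃ c a : L, a ∈ A ∧ (c : G) ∈ Subgroup.centralizer (D : Set G) ∧
      l = c * a := by
  set C : Subgroup L := (Subgroup.centralizer (D : Set G)).subgroupOf L with hC
  have hCn : C.Normal := by
    subst hL
    rw [hC, ← Subgroup.normalizerMonoidHom_ker]; infer_instance
  have hidx : (C ⊔ A).index = 1 := by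
    by_contra hne
    obtain ⟨q, hq, hqd⟩ := Nat.exists_prime_and_dvd hne
    have hqf : Fact q.Prime := ⟨hq⟩
    by_cases hqp : q = p
    · subst hqp
      exact A.not_dvd_index (hqd.trans (Subgroup.index_dvd_of_le le_sup_right))
    · obtain ⟨Q⟩ : Nonempty (Sylow q L) := inferInstance
      have hQC : (Q : Subgroup L) ≤ C := by
        intro y hy
        rw [hC, Subgroup.mem_subgroupOf, Subgroup.mem_centralizer_iff]
        apply h D hD q hq hqp
        · exact Subgroup.mem_normalizer_iff.mp (hL ▸ y.2)
        · obtain ⟨k, hk⟩ := Q.isPGroup' ⟨y, hy⟩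
          refine ⟨k, ?_⟩
          have := congrArg (fun t : (Q : Subgroup L) => ((t : L) : G)) hk
          simpa using this
      exact Q.not_dvd_index (hqd.trans (Subgroup.index_dvd_of_le (hQC.trans le_sup_left)))
  rw [Subgroup.index_eq_one] at hidx
  have hl : l ∈ C ⊔ (A : Subgroup L) := by rw [hidx]; trivial
  rw [Subgroup.mem_sup_of_normal_left] at hl
  obtain ⟨c, hc, a, ha, rfl⟩ := hl
  exact ⟨c, a, ha, hc, rfl⟩

theorem mem_sylow_smul {G : Type*} [Group G] {p : ℕ} (g x : G) (P : Sylow p G) :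
    x ∈ g • P ↔ g⁻¹ * x * g ∈ P := by
  change x ∈ ((g • P : Sylow p G) : Subgroup G) ↔ _
  rw [Sylow.coe_subgroup_smul, Subgroup.mem_pointwise_smul_iff_inv_smul_mem]
  simp [MulAut.smul_def, ← map_inv]
  rfl

theorem frob_grow {G : Type*} [Group G] [Finite G] (p : ℕ) [hp : Fact p.Prime]
    (S : Sylow p G) (D : Subgroup G) (hlt : D < S) :
    ∃ s ∈ S, s ∉ D ∧ s ∈ Subgroup.normalizer (D : Set G) := by
  have : Group.IsNilpotent S := S.isPGroup'.isNilpotent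
  have hn := Group.normalizerCondition_of_isNilpotent (G := S) (D.subgroupOf S) (by
    rw [lt_top_iff_ne_top, Ne, Subgroup.subgroupOf_eq_top]
    exact hlt.not_ge)
  obtain ⟨s, hs1, hs2⟩ := SetLike.exists_of_lt hn
  refine ⟨s, s.2, hs2, ?_⟩
  rw [Subgroup.mem_normalizer_iff] at hs1 ⊢
  intro x
  constructor
  · intro hx
    exact (hs1 ⟨x, hlt.le hx⟩).mp hx
  · intro hx
    have hxS : x ∈ (S : Subgroup G) := by
      have := S.mul_mem (S.mul_mem (S.inv_mem s.2) (hlt.le hx)) s.2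
      simpa [mul_assoc] using this
    exact (hs1 ⟨x, hxS⟩).mpr hx

theorem frob_conj {G : Type*} [Group G] [Finite G] (p : ℕ) [hp : Fact p.Prime]
    (h : FrobCond p G) : ∀ n : ℕ, ∀ S T : Sylow p G,
    Nat.card G - Nat.card ((S : Subgroup G) ⊓ T : Subgroup G) = n →
    ∃ c ∈ Subgroup.centralizer (((S : Subgroup G) ⊓ T : Subgroup G) : Set G), c • S = T := by
  intro n
  induction n using Nat.strong_induction_on with
  | _ n IH =>
  intro S T hn
  by_cases hST : S = T
  · subst hST
    exact ⟨1, Subgroup.one_mem _, one_smul _ _⟩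
  set D : Subgroup G := (S : Subgroup G) ⊓ T with hDdef
  have hDS : D < S := by
    refine lt_of_le_of_ne inf_le_left fun he => hST ?_
    have : (S : Subgroup G) ≤ T := inf_eq_left.mp he
    exact Sylow.ext (S.is_maximal' T.isPGroup' this).symm
  have hDT : D < T := by
    refine lt_of_le_of_ne inf_le_right fun he => hST ?_
    have : (T : Subgroup G) ≤ S := inf_eq_right.mp he
    exact Sylow.ext (T.is_maximal' S.isPGroup' this)
  have hD : IsPGroup p D := S.isPGroup'.to_le hDS.le
  have step : ∀ X Y : Sylow p G, D < (X : Subgroup G) ⊓ Y →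
      ∃ c ∈ Subgroup.centralizer (D : Set G), c • X = Y := by
    intro X Y hlt
    have hc : Nat.card D < Nat.card ((X : Subgroup G) ⊓ Y : Subgroup G) :=
      Set.ncard_lt_ncard hlt (Set.toFinite _)
    have hle : Nat.card ((X : Subgroup G) ⊓ Y : Subgroup G) ≤ Nat.card G :=
      Subgroup.card_le_card_group _
    obtain ⟨c, hc, hcc⟩ := IH _ (by omega) X Y rfl
    exact ⟨c, Subgroup.centralizer_le (SetLike.coe_subset_coe.mpr hlt.le) hc, hcc⟩
  set L := Subgroup.normalizer (D : Set G) with hL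
  have hDL : D ≤ L := Subgroup.le_normalizer
  have hsubp : ∀ X : Sylow p G, IsPGroup p ((X : Subgroup G).subgroupOf L) := fun X =>
    X.isPGroup'.comap_subtype
  obtain ⟨A, hA⟩ := (hsubp S).exists_le_sylow
  obtain ⟨B, hB⟩ := (hsubp T).exists_le_sylow
  obtain ⟨U, hU⟩ := (A.isPGroup'.map L.subtype).exists_le_sylow
  obtain ⟨l, hl⟩ := MulAction.exists_smul_eq L A B
  obtain ⟨k, a, ha, hk, rfl⟩ := frob_decomp p h D hD L hL A l
  have hkA : k • A = B := by
    rw [← hl, mul_smul, Sylow.smul_eq_iff_mem_normalizer.mpr (Subgroup.le_normalizer ha)]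
  obtain ⟨c1, hc1, hc1'⟩ := step S U (by
    obtain ⟨s, hs1, hs2, hs3⟩ := frob_grow p S D hDS
    refine lt_of_le_of_ne (le_inf hDS.le fun x hx => hU ⟨⟨x, hDL hx⟩, hA (hDS.le hx), rfl⟩) ?_
    intro he
    apply hs2
    rw [he]
    exact ⟨hs1, hU ⟨⟨s, hs3⟩, hA hs1, rfl⟩⟩)
  have hBV : ∀ x : L, x ∈ B → (x : G) ∈ (k : G) • U := by
    intro x hx
    rw [mem_sylow_smul]
    rw [← hkA, mem_sylow_smul] at hx
    exact hU ⟨_, hx, rfl⟩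
  obtain ⟨c2, hc2, hc2'⟩ := step ((k : G) • U) T (by
    obtain ⟨s, hs1, hs2, hs3⟩ := frob_grow p T D hDT
    refine lt_of_le_of_ne (le_inf (fun x hx => hBV ⟨x, hDL hx⟩ (hB (hDT.le hx))) hDT.le) ?_
    intro he
    apply hs2
    rw [he]
    exact ⟨hBV ⟨s, hs3⟩ (hB hs1), hs1⟩)
  refine ⟨c2 * k * c1, Subgroup.mul_mem _ (Subgroup.mul_mem _ hc2 hk) hc1, ?_⟩
  rw [mul_smul, mul_smul, hc1', hc2']

theorem mem_compl_iff {G : Type*} [Group G] [Finite G] (p : ℕ) (hp : p.Prime) (H : Subgroup G)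
    [H.Normal] (hi : ∃ n : ℕ, H.index = p ^ n) (hc : ¬ p ∣ Nat.card H) (x : G) :
    x ∈ H ↔ (orderOf x).Coprime p := by
  constructor
  · intro hx
    have h1 : orderOf x ∣ Nat.card H := by
      have := orderOf_dvd_natCard (⟨x, hx⟩ : H)
      rwa [Subgroup.orderOf_mk] at this
    exact Nat.Coprime.symm ((Nat.Prime.coprime_iff_not_dvd hp).mpr fun h => hc (h.trans h1))
  · intro hx
    obtain ⟨n, hn⟩ := hi
    rw [← QuotientGroup.eq_one_iff, ← orderOf_eq_one_iff]
    refine Nat.eq_one_of_dvd_coprimes (hx.pow_right n) ?_ ?_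
    · exact orderOf_map_dvd (QuotientGroup.mk' H) x
    · rw [← hn]; exact orderOf_dvd_natCard _

theorem frob_sub {G : Type*} [Group G] (p : ℕ) (h : FrobCond p G) (K : Subgroup G) :
    FrobCond p K := by
  intro D hD q hq hqp g hg hk x hx
  obtain ⟨k, hk⟩ := hk
  have := h (D.map K.subtype) (hD.map _) q hq hqp g ?_ ⟨k, ?_⟩ x ⟨x, hx, rfl⟩
  · exact Subtype.ext this
  · intro y
    constructor
    · rintro ⟨y, hy, rfl⟩
      exact ⟨g * y * g⁻¹, (hg y).mp hy, rfl⟩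
    · rintro ⟨z, hz, hz'⟩
      refine ⟨g⁻¹ * z * g, (hg _).mpr ?_, ?_⟩
      · simpa [mul_assoc] using hz
      · have : (z : G) = g * y * g⁻¹ := hz'
        simp [this, mul_assoc]
  · have := congrArg (fun t : K => (t : G)) hk
    simpa using this

theorem frob_main (p : ℕ) [hp : Fact p.Prime] : ∀ n : ℕ, ∀ (G : Type u) [Group G] [Finite G],
    Nat.card G = n → FrobCond p G → IsPNilpotent p G := by
  intro n
  induction n using Nat.strong_induction_on with
  | _ n IH =>
  intro G _ _ hcard h
  obtain ⟨P⟩ : Nonempty (Sylow p G) := inferInstance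
  by_cases hP : (P : Subgroup G) = ⊥
  · refine ⟨⊤, inferInstance, ⟨0, by simp⟩, ?_⟩
    have := P.not_dvd_index
    rw [hP, Subgroup.index_bot] at this
    simpa using this
  have hPnt : Nontrivial P := (Subgroup.nontrivial_iff_ne_bot _).mpr hP
  have : Group.IsNilpotent P := P.isPGroup'.isNilpotent
  have hfoc : Subgroup.focalSubgroupOf (P : Subgroup G) ≤ commutator P := by
    rw [Subgroup.focalSubgroupOf_eq_closure, Subgroup.closure_le]
    rintro y ⟨x, hx, u, hy⟩
    -- y = [x, u]
    have hxu : u * x * u⁻¹ ∈ (P : Subgroup G) := by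
      have h1 : u * x * u⁻¹ = (y : G)⁻¹ * x := by rw [hy, commutatorElement_def]; group
      rw [h1]
      exact P.mul_mem (P.inv_mem y.2) hx
    obtain ⟨c, hc, hcP⟩ := frob_conj p h _ P (u • P) rfl
    have hcx : u * x * u⁻¹ * c = c * (u * x * u⁻¹) := by
      apply Subgroup.mem_centralizer_iff.mp hc
      refine ⟨hxu, ?_⟩
      change u * x * u⁻¹ ∈ u • P
      rw [mem_sylow_smul]
      have : u⁻¹ * (u * x * u⁻¹) * u = x := by group
      rw [this]
      exact hx
    have hN : c⁻¹ * u ∈ Subgroup.normalizer ((P : Subgroup G) : Set G) := by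
      apply Sylow.smul_eq_iff_mem_normalizer.mp
      rw [mul_smul, ← hcP, inv_smul_smul]
    obtain ⟨k, a, ha, hk, hka⟩ := frob_decomp p h P P.isPGroup' _ rfl
      (P.subtype Subgroup.le_normalizer) ⟨_, hN⟩
    have haP : (a : G) ∈ (P : Subgroup G) := ha
    have hka' : c⁻¹ * u = k * a := congrArg Subtype.val hka
    have hk' := Subgroup.mem_centralizer_iff.mp hk (a * x * (a : G)⁻¹)
      (P.mul_mem (P.mul_mem haP hx) (P.inv_mem haP))
    have e1 : u * x * u⁻¹ = a * x * (a : G)⁻¹ := by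
      have e2 : u * x * u⁻¹ = c⁻¹ * (u * x * u⁻¹) * c := by
        rw [mul_assoc c⁻¹, hcx]; group
      have e3 : c⁻¹ * (u * x * u⁻¹) * c = (c⁻¹ * u) * x * (c⁻¹ * u)⁻¹ := by group
      rw [e2, e3, hka']
      calc (k : G) * a * x * (k * a : G)⁻¹ = (k * (a * x * (a : G)⁻¹)) * (k : G)⁻¹ := by group
        _ = _ := by rw [← hk']; group
    have e4 : y = ⁅(⟨x, hx⟩ : (P : Subgroup G)), (⟨a, haP⟩ : (P : Subgroup G))⁆ := by
      apply Subtype.ext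
      rw [hy]
      change x * u * x⁻¹ * u⁻¹ = x * a * x⁻¹ * (a : G)⁻¹
      have e5 : (u * x * u⁻¹)⁻¹ = (a * x * (a : G)⁻¹)⁻¹ := by rw [e1]
      calc x * u * x⁻¹ * u⁻¹ = x * (u * x * u⁻¹)⁻¹ := by group
        _ = _ := by rw [e5]; group
    rw [e4]
    exact Subgroup.commutator_mem_commutator (Subgroup.mem_top _) (Subgroup.mem_top _)
  have hlt : Subgroup.focalSubgroupOf (P : Subgroup G) < ⊤ :=
    lt_of_le_of_lt hfoc (Group.IsSolvable.commutator_lt_top_of_nontrivial P)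
  set f := Subgroup.transferFocal (P : Subgroup G) with hf
  have hfs : Function.Surjective f := Subgroup.transferFocal_surjective P
  have hKi : f.ker.index = (Subgroup.focalSubgroupOf (P : Subgroup G)).index := by
    rw [Subgroup.index_ker, MonoidHom.range_eq_top.mpr hfs, Subgroup.card_top]; rfl
  obtain ⟨m, hm⟩ : ∃ m, f.ker.index = p ^ m := by
    rw [hKi]
    exact P.isPGroup'.index _
  have hKlt : Nat.card f.ker < n := by
    have h1 := f.ker.card_mul_index
    have h2 : f.ker.index ≠ 1 := by
      rw [hKi, Ne, Subgroup.index_eq_one]; exact hlt.ne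
    have h3 : f.ker.index ≠ 0 := Subgroup.FiniteIndex.index_ne_zero
    have h4 : 0 < Nat.card f.ker := Nat.card_pos
    rw [← hcard, ← h1]
    exact lt_mul_of_one_lt_right h4 (by omega)
  obtain ⟨H, hHn, ⟨j, hj⟩, hHc⟩ := IH _ hKlt f.ker rfl (frob_sub p h f.ker)
  refine ⟨H.map f.ker.subtype, ⟨?_⟩, ⟨j + m, ?_⟩, ?_⟩
  · rintro _ ⟨x, hx, rfl⟩ g
    have hx' := (mem_compl_iff p hp.out H ⟨j, hj⟩ hHc x).mp hx
    have hgx : g * x * g⁻¹ ∈ f.ker := MonoidHom.normal_ker f |>.conj_mem x x.2 g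
    refine ⟨⟨_, hgx⟩, (mem_compl_iff p hp.out H ⟨j, hj⟩ hHc _).mpr ?_, rfl⟩
    rw [Subgroup.orderOf_mk]
    have : orderOf (g * (x : G) * g⁻¹) = orderOf x := by
      rw [← Subgroup.orderOf_coe]
      exact orderOf_injective (MulAut.conj g).toMonoidHom (MulAut.conj g).injective (x : G)
    rwa [this]
  · rw [Subgroup.index_map_subtype, hj, hm, pow_add]
  · rw [Subgroup.card_map_of_injective f.ker.subtype_injective]
    exact hHc

theorem zpowers_sq_of_lt {G : Type*} [Group G] (x : G) (hx : orderOf x = 4) (B : Subgroup G)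
    (hB : B ≤ Subgroup.zpowers x) (hxB : x ∉ B) : B ≤ Subgroup.zpowers (x ^ 2) := by
  intro b hb
  obtain ⟨k, rfl⟩ := Subgroup.mem_zpowers_iff.mp (hB hb)
  rcases Int.even_or_odd' k with ⟨j, rfl | rfl⟩
  · rw [Subgroup.mem_zpowers_iff]
    exact ⟨j, by rw [zpow_mul]; norm_cast⟩
  · exfalso
    apply hxB
    have h4 : x ^ (4 : ℤ) = 1 := by
      have := pow_orderOf_eq_one x
      rw [hx] at this
      exact_mod_cast this
    have h1 : (x ^ (2 * j + 1)) ^ (2 * j + 1) = x := by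
      rw [← zpow_mul]
      have : (2 * j + 1) * (2 * j + 1) = 4 * (j * j + j) + 1 := by ring
      rw [this, zpow_add, zpow_mul, h4]; simp
    rw [← h1]
    exact B.zpow_mem hb _

theorem ws_cases {G : Type*} [Group G] [Finite G] (x : G) (hx : orderOf x = 4)
    (hcen : x ^ 2 ∈ Subgroup.center G) (h : WeaklySPhiSupplemented (Subgroup.zpowers x)) :
    IsSPermutable (Subgroup.zpowers x) ∨ ∃ M : Subgroup G, M.index = 2 ∧ x ∉ M := by
  by_cases hS : IsSPermutable (Subgroup.zpowers x)
  · exact Or.inl hS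
  right
  have hxZ : x ∉ Subgroup.zpowers (x ^ 2) := by
    intro hm
    have h1 : orderOf x ∣ orderOf (x ^ 2) := orderOf_dvd_of_mem_zpowers hm
    rw [orderOf_pow, hx] at h1
    norm_num at h1
  obtain ⟨T, hT, hAT⟩ := h
  have hcore : sCore (Subgroup.zpowers x) ≤ Subgroup.zpowers (x ^ 2) := by
    unfold sCore
    refine iSup₂_le ?_
    rintro B ⟨hB, hBS⟩
    apply zpowers_sq_of_lt x hx B hB
    intro hxB
    apply hS
    have : B = Subgroup.zpowers x := le_antisymm hB (by rwa [Subgroup.zpowers_le])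
    rwa [← this]
  have hfr : (frattini (Subgroup.zpowers x)).map (Subgroup.zpowers x).subtype ≤
      Subgroup.zpowers (x ^ 2) := by
    set A := Subgroup.zpowers x with hA
    have hco : IsCoatom ((Subgroup.zpowers (x ^ 2)).subgroupOf A) := by
      constructor
      · rw [Ne, Subgroup.subgroupOf_eq_top, Subgroup.zpowers_le]
        exact hxZ
      · intro B hB
        by_contra hne
        refine hB.not_ge ?_
        intro b hb
        have := zpowers_sq_of_lt x hx (B.map A.subtype) (Subgroup.map_subtype_le B) ?_
          (Subgroup.mem_map_of_mem _ hb)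
        · exact this
        · rintro ⟨y, hy, hyx⟩
          apply hne
          rw [eq_top_iff]
          rintro ⟨w, hw⟩ -
          obtain ⟨k, hk⟩ := Subgroup.mem_zpowers_iff.mp hw
          have : (⟨w, hw⟩ : A) = y ^ k := by
            apply Subtype.ext
            change w = (y : G) ^ k
            rw [← hk, ← hyx]; rfl
          rw [this]
          exact B.zpow_mem hy k
    rintro _ ⟨y, hy, rfl⟩
    exact frattini_le_coatom hco hy
  have hATZ : Subgroup.zpowers x ⊓ T ≤ Subgroup.zpowers (x ^ 2) := hAT.trans (sup_le hfr hcore)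
  have hZc : Subgroup.zpowers (x ^ 2) ≤ Subgroup.center G := by rwa [Subgroup.zpowers_le]
  have hZn : (Subgroup.zpowers (x ^ 2)).Normal := ⟨fun n hn g => by
    have := Subgroup.mem_center_iff.mp (hZc hn) g
    rw [this]; simpa using hn⟩
  have hZA : Subgroup.zpowers (x ^ 2) ≤ Subgroup.zpowers x := by
    rw [Subgroup.zpowers_le]
    exact Subgroup.pow_mem _ (Subgroup.mem_zpowers x) 2
  suffices hmain : x ∉ Subgroup.zpowers (x ^ 2) ⊔ T ∧
      (x ∉ Subgroup.zpowers (x ^ 2) ⊔ T → (Subgroup.zpowers (x ^ 2) ⊔ T).index = 2) from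
    ⟨_, hmain.2 hmain.1, hmain.1⟩
  refine ⟨?_, ?_⟩
  · intro hm
    rw [Subgroup.mem_sup_of_normal_left] at hm
    obtain ⟨z, hz, t, ht, hzt⟩ := hm
    apply hxZ
    have htA : t ∈ Subgroup.zpowers x := by
      have : t = z⁻¹ * x := by rw [← hzt]; group
      rw [this]
      exact Subgroup.mul_mem _ (Subgroup.inv_mem _ (hZA hz)) (Subgroup.mem_zpowers x)
    have := Subgroup.mul_mem _ hz (hATZ ⟨htA, ht⟩)
    rwa [hzt] at this
  · intro hxM
    rw [Subgroup.index_eq_two_iff']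
    refine ⟨x, fun b => ?_⟩
    by_cases hb : b ∈ Subgroup.zpowers (x ^ 2) ⊔ T
    · exact Or.inr ⟨hb, fun h => hxM ((Subgroup.mul_mem_cancel_right _ hb).mp h)⟩
    · refine Or.inl ⟨?_, hb⟩
      obtain ⟨a, ha, t, ht, hat⟩ := Set.mem_mul.mp (hT.symm ▸ Set.mem_univ b)
      have htM : t ∈ Subgroup.zpowers (x ^ 2) ⊔ T := Subgroup.mem_sup_right ht
      have hzM : ∀ j : ℤ, x ^ (2 * j) ∈ Subgroup.zpowers (x ^ 2) ⊔ T := by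
        intro j
        apply Subgroup.mem_sup_left
        rw [Subgroup.mem_zpowers_iff]
        exact ⟨j, by rw [zpow_mul]; norm_cast⟩
      obtain ⟨k, rfl⟩ := Subgroup.mem_zpowers_iff.mp ha
      rw [← hat] at hb ⊢
      rcases Int.even_or_odd' k with ⟨j, rfl | rfl⟩
      · exact absurd (Subgroup.mul_mem _ (hzM j) htM) hb
      · have : x * (x ^ (2 * j + 1) * t) = x ^ (2 * (j + 1)) * t := by
          rw [← mul_assoc, ← zpow_one_add]; congr 2; ring
        rw [this]
        exact Subgroup.mul_mem _ (hzM (j + 1)) htM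

theorem sperm_conj {G : Type*} [Group G] [Finite G] (p q : ℕ) (hp : p.Prime) (hq : q.Prime)
    (hqp : q ≠ p) (E : Subgroup G) (hE : IsPGroup p E) (g : G) (hg : ∃ k, g ^ (q ^ k) = 1)
    (hgE : ∀ x ∈ E, g * x * g⁻¹ ∈ E) (e : G) (he : e ∈ E)
    (hS : IsSPermutable (Subgroup.zpowers e)) : g * e * g⁻¹ ∈ Subgroup.zpowers e := by
  have : Fact p.Prime := ⟨hp⟩
  have : Fact q.Prime := ⟨hq⟩
  have hgp : IsPGroup q (Subgroup.zpowers g) := by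
    obtain ⟨k, hk⟩ := hg
    rintro ⟨y, hy⟩
    obtain ⟨j, rfl⟩ := Subgroup.mem_zpowers_iff.mp hy
    refine ⟨k, Subtype.ext ?_⟩
    change (g ^ j) ^ (q ^ k) = 1
    rw [← zpow_natCast, ← zpow_mul, mul_comm, zpow_mul, zpow_natCast, hk, one_zpow]
  obtain ⟨R, hR⟩ := hgp.exists_le_sylow
  have hgR : g ∈ R := hR (Subgroup.mem_zpowers g)
  have h1 : g * e ∈ ((R : Subgroup G) : Set G) * (Subgroup.zpowers e : Set G) :=
    Set.mul_mem_mul hgR (Subgroup.mem_zpowers e)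
  rw [← hS q hq R] at h1
  obtain ⟨a, ha, r, hr, har⟩ := Set.mem_mul.mp h1
  have haE : a ∈ E := (Subgroup.zpowers_le.mpr he) ha
  have h2 : a⁻¹ * (g * e * g⁻¹) = r * g⁻¹ := by
    have : g * e = a * r := har.symm
    rw [this]; group
  have hd := IsPGroup.disjoint_of_ne q p hqp R E R.isPGroup' hE
  have h3 : r * g⁻¹ = 1 := by
    rw [Subgroup.disjoint_def] at hd
    apply hd (R.mul_mem hr (R.inv_mem hgR))
    rw [← h2]
    exact E.mul_mem (E.inv_mem haE) (hgE e he)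
  rw [h3] at h2
  rw [← inv_mul_eq_one.mp h2]
  exact ha

theorem frob_of_hyp {G : Type*} [Group G] [Finite G] (p : ℕ) (hp : p.Prime)
    (N : Subgroup G) [N.Normal] (hquot : IsPNilpotent p (G ⧸ N))
    (hmin : ∀ x : G, x ∈ N → orderOf x = p → x ∈ Subgroup.center G)
    (h4 : p = 2 → ∀ x : G, x ∈ N → orderOf x = 4 →
      WeaklySPhiSupplemented (Subgroup.zpowers x)) : FrobCond p G := by
  intro D hD q hq hqp g hgD hgq d hd
  have hpf : Fact p.Prime := ⟨hp⟩
  have hgco : (orderOf g).Coprime p := by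
    obtain ⟨k, hk⟩ := hgq
    exact Nat.Coprime.coprime_dvd_left (orderOf_dvd_of_pow_eq_one hk)
      (((Nat.coprime_primes hq hp).mpr hqp).pow_left k)
  have hE : IsPGroup p (D ⊓ N : Subgroup G) := hD.to_le inf_le_left
  have hEinv : ∀ x ∈ D ⊓ N, g * x * g⁻¹ ∈ D ⊓ N := fun x hx =>
    ⟨(hgD x).mp hx.1, Subgroup.Normal.conj_mem inferInstance x hx.2 g⟩
  have hcp : ∀ c ∈ N, c ^ p = 1 → Commute g c := by
    intro c hc hcp
    by_cases h1 : c = 1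
    · rw [h1]; exact Commute.one_right g
    · exact Subgroup.mem_center_iff.mp (hmin c hc (orderOf_eq_prime hcp h1)) g
  have hcommE : ∀ x ∈ D ⊓ N, Commute g x := by
    have hcE : ∀ x ∈ D ⊓ N, x⁻¹ * (g * x * g⁻¹) ∈ D ⊓ N := fun x hx =>
      Subgroup.mul_mem _ (Subgroup.inv_mem _ hx) (hEinv x hx)
    by_cases hp2 : p = 2
    · refine aux_omega p g hgco 4 (by rw [hp2]; norm_num) (by rw [hp2]; norm_num)
        _ (D ⊓ N) rfl hE hEinv ?_
      intro x hx hc4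
      have hcin := hcE x hx
      have hxM : ∀ M : Subgroup G, M.index = 2 → x⁻¹ * (g * x * g⁻¹) ∈ M := by
        intro M hM
        simp only [Subgroup.mul_mem_iff_of_index_two hM, inv_mem_iff]
        tauto
      set c := x⁻¹ * (g * x * g⁻¹) with hc
      by_cases hc2 : c ^ 2 = 1
      · exact hcp c hcin.2 (by rw [hp2]; exact hc2)
      have hc2f : Fact (Nat.Prime 2) := ⟨Nat.prime_two⟩
      have ho : orderOf c = 4 := by
        have := orderOf_eq_prime_pow (x := c) (p := 2) (n := 1) (by simpa using hc2) (by simpa using hc4)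
        simpa using this
      have hsq : Commute g (c ^ 2) := hcp _ (N.pow_mem hcin.2 2) (by rw [hp2, ← pow_mul]; exact hc4)
      have hsqc : c ^ 2 ∈ Subgroup.center G := by
        apply hmin _ (N.pow_mem hcin.2 2)
        rw [hp2]
        exact orderOf_eq_prime (by rw [← pow_mul]; exact hc4) hc2
      rcases ws_cases c ho hsqc (h4 hp2 c hcin.2 ho) with hS | ⟨M, hM, hcM⟩
      · have hz := sperm_conj p q hp hq hqp (D ⊓ N) hE g hgq hEinv c hcin hS
        obtain ⟨k, hk⟩ := Subgroup.mem_zpowers_iff.mp hz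
        rcases Int.even_or_odd' k with ⟨j, rfl | rfl⟩
        · exfalso
          apply hc2
          have e1 : (g * c * g⁻¹) ^ 2 = 1 := by
            rw [← hk, ← zpow_natCast, ← zpow_mul]
            have : (2 * j) * ((2 : ℕ) : ℤ) = ((4 : ℕ) : ℤ) * j := by push_cast; ring
            rw [this, zpow_mul, zpow_natCast, hc4, one_zpow]
          rw [conj_pow] at e1
          exact conj_eq_one_iff.mp e1
        · have e2 : c ^ (2 * j + 1) = c * (c ^ 2) ^ j := by
            rw [zpow_add, zpow_one, zpow_mul]
            norm_cast
            exact ((Commute.refl c).pow_left 2).zpow_left j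
          have e3 : (c ^ 2) ^ j = 1 := by
            apply aux_coprime g c _ (by rw [← hk, e2]) (hsq.zpow_right j)
            obtain ⟨i, hi⟩ := (IsPGroup.iff_orderOf.mp hE)
              ⟨_, Subgroup.zpow_mem _ (Subgroup.pow_mem _ hcin 2) j⟩
            rw [Subgroup.orderOf_mk] at hi
            rw [hi]
            exact hgco.pow_right i
          rw [e2, e3, mul_one] at hk
          have e4 : c * g = g * c := by
            conv_lhs => rw [hk]
            group
          exact e4.symm
      · exact absurd (hxM M hM) hcM
    · refine aux_omega p g hgco p dvd_rfl ?_ _ (D ⊓ N) rfl hE hEinv ?_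
      · obtain ⟨j, hj⟩ := hp.odd_of_ne_two hp2
        refine ⟨j, ?_⟩
        have : p - 1 = 2 * j := by omega
        rw [this, show p * (2 * j) = p * j * 2 by ring]
        simp
      · intro x hx hc
        exact hcp _ (hcE x hx).2 hc
  obtain ⟨H, hHn, hHi, hHc⟩ := hquot
  set e := d⁻¹ * (g * d * g⁻¹) with he
  have heD : e ∈ D := D.mul_mem (D.inv_mem hd) ((hgD d).mp hd)
  obtain ⟨i, hi⟩ := (IsPGroup.iff_orderOf.mp hD) ⟨e, heD⟩
  rw [Subgroup.orderOf_mk] at hi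
  have heN : e ∈ N := by
    have hgH : (g : G ⧸ N) ∈ H := by
      rw [mem_compl_iff p hp H hHi hHc]
      exact Nat.Coprime.coprime_dvd_left (orderOf_map_dvd (QuotientGroup.mk' N) g) hgco
    have heH : (e : G ⧸ N) ∈ H := by
      have : (e : G ⧸ N) = ((d : G ⧸ N)⁻¹ * g * (d : G ⧸ N)⁻¹⁻¹) * (g : G ⧸ N)⁻¹ := by
        rw [he]; simp [mul_assoc]
      rw [this]
      exact H.mul_mem (hHn.conj_mem _ hgH _) (H.inv_mem hgH)
    rw [mem_compl_iff p hp H hHi hHc] at heH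
    rw [← QuotientGroup.eq_one_iff, ← orderOf_eq_one_iff]
    refine Nat.eq_one_of_dvd_coprimes (heH.pow_right i) dvd_rfl ?_
    rw [← hi]
    exact orderOf_map_dvd (QuotientGroup.mk' N) e
  have he1 : e = 1 := by
    apply aux_coprime g d e (by rw [he]; group) (hcommE e ⟨heD, heN⟩)
    rw [hi]
    exact hgco.pow_right i
  have h2 : d = g * d * g⁻¹ := inv_mul_eq_one.mp (he ▸ he1)
  conv_lhs => rw [h2]
  group

end Aux

theorem stmt5 {G : Type*} [Group G] [Finite G] (p : ℕ) (hp : p.Prime)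
    (N : Subgroup G) [N.Normal] (hquot : IsPNilpotent p (G ⧸ N))
    (hmin : ∀ x : G, x ∈ N → orderOf x = p → x ∈ Subgroup.center G)
    (h4 : p = 2 → ∀ x : G, x ∈ N → orderOf x = 4 →
      WeaklySPhiSupplemented (Subgroup.zpowers x)) :
    IsPNilpotent p G := by
  have : Fact p.Prime := ⟨hp⟩
  exact frob_main p _ G rfl (frob_of_hyp p hp N hquot hmin h4)
end

section
/- Let G be a finite group with a normal subgroup N such that G/N is nilpotent. Suppose every minimal subgroup of the generalized Fitting subgroup F*(N) is contained in Z(G), and every cyclic subgroup of F*(N) of order 4 is weakly SΦ-supplemented in G. Then G is nilpotent. -/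
open scoped Pointwise

open scoped commutatorElement

theorem aux_comm_trivial {G : Type*} [Group G] {y x c : G} {p k : ℕ}
    (hy : (orderOf y).Coprime p) (hc : c ^ p ^ k = 1) (h : y * x * y⁻¹ = c * x)
    (hyc : Commute y c) : c = 1 := by
  have key : ∀ n : ℕ, y ^ n * x = c ^ n * x * y ^ n := by
    intro n
    induction n with
    | zero => simp
    | succ n ih =>
      have h' : y * x = c * x * y := by rw [← h]; group
      have h2 : y * c ^ n = c ^ n * y := (hyc.pow_right n).eq
      calc y ^ (n+1) * x = y * (y ^ n * x) := by rw [pow_succ']; group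
        _ = (y * c ^ n) * x * y ^ n := by rw [ih]; group
        _ = c ^ n * (y * x) * y ^ n := by rw [h2]; group
        _ = c ^ (n+1) * x * y ^ (n+1) := by rw [h', pow_succ c, pow_succ' y]; group
  have h1 := key (orderOf y)
  rw [pow_orderOf_eq_one] at h1
  have h2 : c ^ (orderOf y) = 1 := by simpa using h1.symm
  have h3 : orderOf c ∣ Nat.gcd (orderOf y) (p ^ k) :=
    Nat.dvd_gcd (orderOf_dvd_of_pow_eq_one h2) (orderOf_dvd_of_pow_eq_one hc)
  rw [Nat.Coprime.pow_right k hy] at h3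
  exact orderOf_eq_one_iff.mp (Nat.dvd_one.mp h3)

theorem aux_class_two {G : Type*} [Group G] {c x t : G} (hxc : x * c = t * c * x)
    (htc : Commute t c) (htx : Commute t x) (n : ℕ) :
    (c * x) ^ n = t ^ (n.choose 2) * c ^ n * x ^ n := by
  have h1 : ∀ n : ℕ, x ^ n * c = t ^ n * c * x ^ n := by
    intro n
    induction n with
    | zero => simp
    | succ n ih =>
      calc x ^ (n+1) * c = x * (x ^ n * c) := by rw [pow_succ']; group
        _ = (x * t ^ n) * c * x ^ n := by rw [ih]; group
        _ = t ^ n * (x * c) * x ^ n := by rw [(htx.pow_left n).eq.symm]; group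
        _ = t ^ (n+1) * c * x ^ (n+1) := by rw [hxc, pow_succ t, pow_succ' x]; group
  induction n with
  | zero => simp
  | succ n ih =>
    have hcomm : c ^ n * t ^ n = t ^ n * c ^ n := (htc.pow_pow n n).eq.symm
    calc (c * x) ^ (n+1) = t ^ (n.choose 2) * c ^ n * (x ^ n * c) * x := by
          rw [pow_succ, ih]; group
      _ = t ^ (n.choose 2) * (c ^ n * t ^ n) * c * x ^ n * x := by rw [h1]; group
      _ = t ^ (n.choose 2 + n) * c ^ (n+1) * x ^ (n+1) := by
          rw [hcomm, pow_add, pow_succ c, pow_succ x]; group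
      _ = _ := by
          rw [Nat.choose_succ_succ' n 1, Nat.choose_one_right, add_comm]

/-- A finite nontrivial `p`-group has an index `p` normal subgroup. -/
theorem aux_index_p {P : Type*} [Group P] [Finite P] [Nontrivial P] {p : ℕ} [hp : Fact p.Prime]
    (hP : IsPGroup p P) : ∃ M : Subgroup P, M ≠ ⊤ ∧ (∀ x : P, x ^ p ∈ M) ∧
      ∀ x z : P, ⁅x, z⁆ ∈ M := by
  obtain ⟨n, hn, hcard⟩ := hP.nontrivial_iff_card.mp inferInstance
  obtain ⟨n, rfl⟩ : ∃ m, n = m + 1 := ⟨n - 1, by omega⟩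
  obtain ⟨M, hM⟩ := Sylow.exists_subgroup_card_pow_prime (G := P) p (n := n)
    (by rw [hcard]; exact pow_dvd_pow _ (by omega))
  have hidx : M.index = p := by
    have h1 := M.card_mul_index
    rw [hM, hcard, pow_succ] at h1
    exact Nat.eq_of_mul_eq_mul_left (pow_pos hp.out.pos n) h1
  have hN : M.Normal := Subgroup.normal_of_index_eq_minFac_card (by
    rw [hidx, hcard, hp.out.pow_minFac (by omega)])
  have hq : Nat.card (P ⧸ M) = p := hidx
  refine ⟨M, ?_, ?_, ?_⟩
  · rintro rfl
    rw [Subgroup.index_top] at hidx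
    exact hp.out.one_lt.ne hidx
  · intro x
    rw [← QuotientGroup.eq_one_iff, QuotientGroup.mk_pow]
    conv_lhs => rw [← hq]
    exact pow_card_eq_one'
  · intro x z
    have : IsCyclic (P ⧸ M) := isCyclic_of_prime_card hq
    rw [← QuotientGroup.eq_one_iff]
    have h2 : ((⁅x, z⁆ : P) : P ⧸ M) = ⁅(x : P ⧸ M), (z : P ⧸ M)⁆ := by
      simp [commutatorElement_def]
    rw [h2, commutatorElement_eq_one_iff_mul_comm]
    have := IsCyclic.isMulCommutative (α := P ⧸ M)
    exact mul_comm' _ _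

theorem aux_coprime_fix {G : Type*} [Group G] [Finite G] {p : ℕ} [hp : Fact p.Prime] {y : G}
    (hy : (orderOf y).Coprime p) : ∀ (n : ℕ) (P : Subgroup G), Nat.card P = n → IsPGroup p P →
      (∀ x ∈ P, y * x * y⁻¹ ∈ P) → (∀ x ∈ P, orderOf x = p → Commute y x) →
      (p = 2 → ∀ x ∈ P, orderOf ⁅y, x⁆ = 4 → Commute y ⁅y, x⁆) → ∀ x ∈ P, Commute y x := by
  intro n
  induction n using Nat.strong_induction_on with
  | _ n ih =>
  intro P hPn hP hinv h1 h4
  have IH : ∀ U : Subgroup G, U < P → (∀ x ∈ U, y * x * y⁻¹ ∈ U) → ∀ x ∈ U, Commute y x := by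
    intro U hU hUinv
    refine ih (Nat.card U) ?_ U rfl (hP.to_le hU.le) hUinv (fun x hx => h1 x (hU.le hx))
      (fun h x hx => h4 h x (hU.le hx))
    rw [← hPn]
    exact Set.ncard_lt_ncard hU (Set.toFinite _)
  have hpow : ∀ x ∈ P, ∃ k, x ^ p ^ k = 1 := by
    intro x hx
    obtain ⟨k, hk⟩ := hP ⟨x, hx⟩
    exact ⟨k, by simpa using congrArg Subtype.val hk⟩
  have hcP : ∀ x ∈ P, ⁅y, x⁆ ∈ P := by
    intro x hx
    rw [commutatorElement_def]
    exact P.mul_mem (hinv x hx) (P.inv_mem hx)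
  -- it is enough that commutators are fixed
  have red : ∀ x ∈ P, Commute y ⁅y, x⁆ → Commute y x := by
    intro x hx hc
    obtain ⟨k, hk⟩ := hpow _ (hcP x hx)
    have := aux_comm_trivial (x := x) hy hk (by rw [commutatorElement_def]; group) hc
    exact commutatorElement_eq_one_iff_commute.mp this
  by_contra hcon
  push Not at hcon
  obtain ⟨x₀, hx₀, hne₀⟩ := hcon
  have hnt : Nontrivial P := by
    refine ⟨⟨⟨x₀, hx₀⟩, 1, ?_⟩⟩
    intro h
    apply hne₀
    have : x₀ = 1 := congrArg Subtype.val h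
    rw [this]; exact Commute.one_right y
  -- any proper invariant subgroup is central
  have hcent : ∀ U : Subgroup G, U < P → (∀ x ∈ U, y * x * y⁻¹ ∈ U) →
      (∀ g ∈ P, ∀ x ∈ U, g * x * g⁻¹ ∈ U) → ∀ u ∈ U, ∀ x ∈ P, Commute u x := by
    intro U hU hUy hUP
    have hfix := IH U hU hUy
    let C := Subgroup.centralizer (U : Set G) ⊓ P
    have hcC : ∀ x ∈ P, ⁅y, x⁆ ∈ C := by
      intro x hx
      refine ⟨Subgroup.mem_centralizer_iff.mpr ?_, hcP x hx⟩
      intro u hu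
      have hu' := hUP x⁻¹ (P.inv_mem hx) u hu
      rw [inv_inv] at hu'
      have e1 : y * (x⁻¹ * u * x) = (x⁻¹ * u * x) * y := (hfix _ hu').eq
      have e2 : y * u = u * y := (hfix _ hu).eq
      have e2' : y⁻¹ * u = u * y⁻¹ := ((hfix _ hu).inv_left).eq
      rw [commutatorElement_def]
      symm
      calc y * x * y⁻¹ * x⁻¹ * u = y * x * y⁻¹ * (x⁻¹ * u * x) * x⁻¹ := by group
        _ = y * x * y⁻¹ * ((x⁻¹ * u * x) * y) * y⁻¹ * x⁻¹ := by group
        _ = y * x * y⁻¹ * (y * (x⁻¹ * u * x)) * y⁻¹ * x⁻¹ := by rw [e1]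
        _ = (y * u) * x * y⁻¹ * x⁻¹ := by group
        _ = u * (y * x * y⁻¹ * x⁻¹) := by rw [e2]; group
    have hCP : C = P := by
      by_contra hC
      apply hne₀
      apply red x₀ hx₀
      refine IH C (lt_of_le_of_ne inf_le_right hC) ?_ _ (hcC x₀ hx₀)
      rintro c ⟨hc1, hc2⟩
      refine ⟨?_, hinv c hc2⟩
      replace hc1 := Subgroup.mem_centralizer_iff.mp hc1
      refine Subgroup.mem_centralizer_iff.mpr ?_
      intro u hu
      have e2 : Commute y u := (hfix _ hu)
      have e3 : Commute u c := hc1 u hu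
      exact ((e2.symm.mul_right e3).mul_right e2.symm.inv_right).eq
    intro u hu x hx
    rw [← hCP] at hx
    exact (Subgroup.mem_centralizer_iff.mp hx.1 u hu)
  -- the Frattini-like subgroup
  obtain ⟨M, hMt, hM1, hM2⟩ := aux_index_p hP
  let S : Set G := {g | (∃ x ∈ P, g = x ^ p) ∨ ∃ x ∈ P, ∃ z ∈ P, g = ⁅x, z⁆}
  let U := Subgroup.closure S
  have hUM : U ≤ M.map P.subtype := by
    rw [Subgroup.closure_le]
    rintro g (⟨x, hx, rfl⟩ | ⟨x, hx, z, hz, rfl⟩)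
    · exact ⟨_, hM1 ⟨x, hx⟩, rfl⟩
    · exact ⟨_, hM2 ⟨x, hx⟩ ⟨z, hz⟩, rfl⟩
  have hMP : M.map P.subtype < P := by
    refine lt_of_le_of_ne (Subgroup.map_subtype_le M) ?_
    intro h
    apply hMt
    rw [eq_top_iff]
    rintro ⟨x, hx⟩ -
    have : x ∈ M.map P.subtype := by rw [h]; exact hx
    obtain ⟨z, hz, hzx⟩ := this
    have : z = ⟨x, hx⟩ := Subtype.ext hzx
    rwa [← this]
  have hUP : U < P := lt_of_le_of_lt hUM hMP
  have hUinv : ∀ g : G, (∀ x ∈ P, g * x * g⁻¹ ∈ P) → ∀ x ∈ U, g * x * g⁻¹ ∈ U := by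
    intro g hg x hx
    have : U ≤ U.comap (MulAut.conj g).toMonoidHom := by
      rw [Subgroup.closure_le]
      rintro _ (⟨x, hx, rfl⟩ | ⟨x, hx, z, hz, rfl⟩)
      · apply Subgroup.subset_closure
        left
        exact ⟨g * x * g⁻¹, hg x hx, by simp⟩
      · apply Subgroup.subset_closure
        right
        exact ⟨g * x * g⁻¹, hg x hx, g * z * g⁻¹, hg z hz, by
          simp [commutatorElement_def]; group⟩
    simpa using this hx
  have hUy := hUinv y hinv
  have hUc := hcent U hUP hUy (fun g hg => hUinv g
    (fun x hx => P.mul_mem (P.mul_mem hg hx) (P.inv_mem hg)))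
  have hUfix := IH U hUP hUy
  apply hne₀
  apply red x₀ hx₀
  set c := ⁅y, x₀⁆ with hc
  have hcPm : c ∈ P := hcP x₀ hx₀
  have htU : ⁅x₀, c⁆ ∈ U := Subgroup.subset_closure (Or.inr ⟨_, hx₀, _, hcPm, rfl⟩)
  have hxU : x₀ ^ p ∈ U := Subgroup.subset_closure (Or.inl ⟨_, hx₀, rfl⟩)
  set t := ⁅x₀, c⁆ with ht
  have hxc : x₀ * c = t * c * x₀ := by rw [ht, commutatorElement_def]; group
  have hform := aux_class_two hxc (hUc t htU c hcPm) (hUc t htU x₀ hx₀)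
  have hcx : c * x₀ = y * x₀ * y⁻¹ := by rw [hc, commutatorElement_def]; group
  have htp : t ^ p = 1 := by
    have h2 : Commute (x₀ ^ p) c := hUc _ hxU c hcPm
    have h3 : ∀ n : ℕ, x₀ ^ n * c = t ^ n * c * x₀ ^ n := by
      intro n
      induction n with
      | zero => simp
      | succ n ih =>
        have h5 : x₀ * t ^ n = t ^ n * x₀ := ((hUc t htU x₀ hx₀).pow_left n).eq.symm
        calc x₀ ^ (n+1) * c = x₀ * (x₀ ^ n * c) := by rw [pow_succ']; group
          _ = (x₀ * t ^ n) * c * x₀ ^ n := by rw [ih]; group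
          _ = t ^ n * (x₀ * c) * x₀ ^ n := by rw [h5]; group
          _ = t ^ (n+1) * c * x₀ ^ (n+1) := by rw [hxc, pow_succ t, pow_succ' x₀]; group
    have h4 := h3 p
    rw [h2.eq] at h4
    have h5 : c = t ^ p * c := mul_right_cancel h4
    simpa using h5.symm
  have hyx : y * x₀ ^ p * y⁻¹ = x₀ ^ p := by
    rw [(hUfix _ hxU).eq]; group
  have hcase : c ^ p = 1 ∨ (p = 2 ∧ c ^ 4 = 1) := by
    rcases hp.out.eq_two_or_odd with h2 | hodd
    · right
      refine ⟨h2, ?_⟩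
      have h5 := hform 4
      have h6 : (c * x₀) ^ 4 = x₀ ^ 4 := by
        have : (c * x₀) ^ p = x₀ ^ p := by rw [hcx, conj_pow, hyx]
        rw [h2] at this
        calc (c * x₀) ^ 4 = ((c * x₀) ^ 2) ^ 2 := by rw [← pow_mul]
          _ = x₀ ^ 4 := by rw [this, ← pow_mul]
      rw [h6] at h5
      have h7 : t ^ (Nat.choose 4 2) = 1 := by
        rw [h2] at htp
        have : Nat.choose 4 2 = 2 * 3 := by decide
        rw [this, pow_mul, htp, one_pow]
      rw [h7, one_mul] at h5
      simpa using h5.symm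
    · left
      have h5 := hform p
      have : (c * x₀) ^ p = x₀ ^ p := by rw [hcx, conj_pow, hyx]
      rw [this] at h5
      have h7 : t ^ (Nat.choose p 2) = 1 := by
        have : p ∣ p.choose 2 := hp.out.dvd_choose_self (by norm_num) (by
          have := hp.out.two_le; omega)
        obtain ⟨m, hm⟩ := this
        rw [hm, pow_mul, htp, one_pow]
      rw [h7, one_mul] at h5
      simpa using h5.symm
  by_cases hc1 : c = 1
  · rw [hc1]; exact Commute.one_right y
  rcases hcase with h | ⟨h2, h⟩
  · exact h1 c hcPm (orderOf_eq_prime h hc1)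
  · by_cases h5 : c ^ 2 = 1
    · subst h2
      exact h1 c hcPm (orderOf_eq_prime h5 hc1)
    · exact h4 h2 x₀ hx₀ (orderOf_eq_prime_pow (p := 2) (n := 1) (by simpa using h5) (by simpa using h))

/-- The condition on elements of order four that passes to subgroups. -/
def AuxGood {G : Type*} [Group G] (x : G) : Prop :=
  IsSPermutable (Subgroup.zpowers x) ∨ ∃ T : Subgroup G, T.index = 2 ∧ x ∉ T

theorem aux_isPGroup_zpowers {G : Type*} [Group G] {p k : ℕ} {x : G} (hx : x ^ p ^ k = 1) :
    IsPGroup p (Subgroup.zpowers x) := by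
  rintro ⟨_, n, rfl⟩
  refine ⟨k, Subtype.ext ?_⟩
  change (x ^ n) ^ p ^ k = 1
  rw [← zpow_natCast, ← zpow_mul, mul_comm, zpow_mul, zpow_natCast, hx, one_zpow]

theorem aux_pow_of_mem {G : Type*} [Group G] {p : ℕ} {P : Subgroup G} (hP : IsPGroup p P) {x : G}
    (hx : x ∈ P) : ∃ k, x ^ p ^ k = 1 := by
  obtain ⟨k, hk⟩ := hP ⟨x, hx⟩
  exact ⟨k, by simpa using congrArg Subtype.val hk⟩

theorem aux_eq_one {G : Type*} [Group G] {p q k l : ℕ} (hpq : Nat.Coprime p q) {x : G}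
    (h1 : x ^ p ^ k = 1) (h2 : x ^ q ^ l = 1) : x = 1 := by
  have h3 : orderOf x ∣ Nat.gcd (p ^ k) (q ^ l) :=
    Nat.dvd_gcd (orderOf_dvd_of_pow_eq_one h1) (orderOf_dvd_of_pow_eq_one h2)
  rw [Nat.Coprime.pow k l hpq] at h3
  exact orderOf_eq_one_iff.mp (Nat.dvd_one.mp h3)

theorem aux_sperm_commute {G : Type*} [Group G] [Finite G] {q k : ℕ} (hq : q.Prime) (hq2 : q ≠ 2)
    {P : Subgroup G} [P.Normal] (hP : IsPGroup 2 P) {x y : G} (hx : x ∈ P) (hx4 : orderOf x = 4)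
    (hs : IsSPermutable (Subgroup.zpowers x)) (hy : y ^ q ^ k = 1) : Commute y x := by
  have : Fact q.Prime := ⟨hq⟩
  have hcop : Nat.Coprime 2 q := (Nat.coprime_primes Nat.prime_two hq).mpr hq2.symm
  obtain ⟨Q, hQ⟩ := (aux_isPGroup_zpowers hy).exists_le_sylow
  have hyQ : y ∈ (Q : Subgroup G) := hQ (Subgroup.mem_zpowers y)
  have hs' := hs q hq Q
  have hmem : y * x ∈ ((Subgroup.zpowers x : Subgroup G) : Set G) * ((Q : Subgroup G) : Set G) := by
    rw [hs']
    exact Set.mul_mem_mul hyQ (Subgroup.mem_zpowers x)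
  obtain ⟨a, ha, b, hb, hab⟩ := Set.mem_mul.mp hmem
  have hxP : Subgroup.zpowers x ≤ P := by simpa using hx
  have h1 : a⁻¹ * (y * x * y⁻¹) = b * y⁻¹ := by
    rw [← hab]; group
  have hbP : b * y⁻¹ ∈ P := by
    rw [← h1]
    exact P.mul_mem (P.inv_mem (hxP ha)) (Subgroup.Normal.conj_mem inferInstance x hx y)
  have hbQ : b * y⁻¹ ∈ (Q : Subgroup G) := Subgroup.mul_mem _ hb (Subgroup.inv_mem _ hyQ)
  obtain ⟨k1, hk1⟩ := aux_pow_of_mem hP hbP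
  obtain ⟨k2, hk2⟩ := aux_pow_of_mem Q.isPGroup' hbQ
  have h2 : b * y⁻¹ = 1 := aux_eq_one hcop hk1 hk2
  rw [h2] at h1
  have h3 : y * x * y⁻¹ = a := by rw [inv_mul_eq_one] at h1; exact h1.symm
  obtain ⟨m, rfl⟩ := Subgroup.mem_zpowers_iff.mp ha
  -- the square of `y` commutes with `x`
  have h4 : (4 : ℤ) ∣ m * m - 1 := by
    have hm : Odd m := by
      by_contra hm
      rw [Int.not_odd_iff_even] at hm
      obtain ⟨r, rfl⟩ := hm
      have h5 : (y * x * y⁻¹) ^ 2 = 1 := by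
        rw [h3, ← zpow_natCast, ← zpow_mul]
        have : (r + r) * ((2 : ℕ) : ℤ) = ((orderOf x : ℕ) : ℤ) * r := by
          rw [hx4]; push_cast; ring
        rw [this, zpow_mul, zpow_natCast, pow_orderOf_eq_one, one_zpow]
      rw [conj_pow, conj_eq_one_iff] at h5
      have := orderOf_dvd_of_pow_eq_one h5
      rw [hx4] at this
      norm_num at this
    obtain ⟨r, rfl⟩ := hm
    exact ⟨r * r + r, by ring⟩
  obtain ⟨r, hr⟩ := h4
  have h5 : y ^ 2 * x * (y ^ 2)⁻¹ = x := by
    calc y ^ 2 * x * (y ^ 2)⁻¹ = y * (y * x * y⁻¹) * y⁻¹ := by rw [pow_two]; group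
      _ = (x ^ m) ^ m := by rw [h3, ← conj_zpow, h3]
      _ = x ^ (m * m - 1) * x := by rw [← zpow_mul, ← zpow_add_one]; ring_nf
      _ = x := by
        have : (4 : ℤ) = ((orderOf x : ℕ) : ℤ) := by rw [hx4]; rfl
        rw [hr, this, zpow_mul, zpow_natCast, pow_orderOf_eq_one, one_zpow, one_mul]
  have h6 : Commute (y ^ 2) x := by
    have : y ^ 2 * x = x * y ^ 2 := by
      conv_rhs => rw [← h5]
      group
    exact this
  have h7 : Nat.Coprime (orderOf y) 2 :=
    Nat.Coprime.coprime_dvd_left (orderOf_dvd_of_pow_eq_one hy) (Nat.Coprime.pow_left k hcop.symm)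
  obtain ⟨n, hn⟩ := exists_pow_eq_self_of_coprime h7.symm
  rw [← hn]
  exact h6.pow_left n

theorem aux_mem_index_two {G : Type*} [Group G] {T : Subgroup G} (hT : T.index = 2) (x y : G) :
    ⁅x, y⁆ ∈ T := by
  have hmul := fun a b : G => Subgroup.mul_mem_iff_of_index_two hT (a := a) (b := b)
  have hinv := fun a : G => T.inv_mem_iff (x := a)
  rw [commutatorElement_def, hmul, hmul, hmul, hinv, hinv]
  tauto

theorem aux_lemC {G : Type*} [Group G] [Finite G] {p q k : ℕ} (hp : p.Prime) (hq : q.Prime)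
    (hpq : p ≠ q) {P : Subgroup G} [P.Normal] (hP : IsPGroup p P)
    (h1 : ∀ x ∈ P, Nat.Prime (orderOf x) → x ∈ Subgroup.center G)
    (h4 : ∀ x ∈ P, orderOf x = 4 → AuxGood x) {y : G} (hy : y ^ q ^ k = 1) {x : G} (hx : x ∈ P) :
    Commute y x := by
  have : Fact p.Prime := ⟨hp⟩
  have hcop : Nat.Coprime (orderOf y) p :=
    Nat.Coprime.coprime_dvd_left (orderOf_dvd_of_pow_eq_one hy)
      (Nat.Coprime.pow_left k ((Nat.coprime_primes hq hp).mpr hpq.symm))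
  refine aux_coprime_fix hcop _ P rfl hP ?_ ?_ ?_ x hx
  · intro x hx
    exact Subgroup.Normal.conj_mem inferInstance x hx y
  · intro x hx hxp
    exact Subgroup.mem_center_iff.mp (h1 x hx (hxp ▸ hp)) y
  · rintro rfl x hx hx4
    have hcP : ⁅y, x⁆ ∈ P := by
      rw [commutatorElement_def]
      exact P.mul_mem (Subgroup.Normal.conj_mem inferInstance x hx y) (P.inv_mem hx)
    rcases h4 _ hcP hx4 with hs | ⟨T, hT, hxT⟩
    · exact aux_sperm_commute hq hpq.symm hP hcP hx4 hs hy
    · exact absurd (aux_mem_index_two hT y x) hxT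

theorem aux_all_sylow {G : Type*} [Group G] [Finite G] (L : Subgroup G)
    (h : ∀ (r : ℕ), r.Prime → ∃ S : Sylow r G, (S : Subgroup G) ≤ L) : L = ⊤ := by
  rw [← Subgroup.index_eq_one]
  by_contra hne
  obtain ⟨r, hr, hdvd⟩ := Nat.exists_prime_and_dvd hne
  have : Fact r.Prime := ⟨hr⟩
  obtain ⟨S, hSL⟩ := h r hr
  exact S.not_dvd_index (hdvd.trans (Subgroup.index_dvd_of_le hSL))

theorem aux_all_prime_pow {G : Type*} [Group G] [Finite G] (L : Subgroup G)
    (h : ∀ (r k : ℕ) (g : G), r.Prime → g ^ r ^ k = 1 → g ∈ L) : L = ⊤ := by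
  refine aux_all_sylow L fun r hr => ⟨default, ?_⟩
  intro g hg
  obtain ⟨k, hk⟩ := aux_pow_of_mem (Sylow.isPGroup' _) hg
  exact h r k g hr hk

theorem aux_mem_of_prime_pow {G : Type*} [Group G] [Finite G] (L : Subgroup G) (v : G)
    (h : ∀ (r k : ℕ) (g : G), r.Prime → g ∈ Subgroup.zpowers v → g ^ r ^ k = 1 → g ∈ L) :
    v ∈ L := by
  have := aux_all_prime_pow (L.subgroupOf (Subgroup.zpowers v)) (by
    rintro r k ⟨g, hg⟩ hr hgr
    exact h r k g hr hg (by simpa using congrArg Subtype.val hgr))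
  have h2 : (⟨v, Subgroup.mem_zpowers v⟩ : Subgroup.zpowers v) ∈
      L.subgroupOf (Subgroup.zpowers v) := by rw [this]; trivial
  exact h2

theorem aux_exists_core {G : Type*} [Group G] [Finite G] (K : Subgroup G) [K.Normal]
    (hK : Group.IsNilpotent K) {p : ℕ} (hp : p.Prime) : ∃ O : Subgroup G, O.Normal ∧ O ≤ K ∧
      IsPGroup p O ∧ ∀ (k : ℕ), ∀ x ∈ K, x ^ p ^ k = 1 → x ∈ O := by
  have : Fact p.Prime := ⟨hp⟩
  let S : Sylow p K := default
  have hS : (S : Subgroup K).Normal := inferInstance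
  have hchar : (S : Subgroup K).Characteristic := S.characteristic_of_normal hS
  refine ⟨(S : Subgroup K).map K.subtype, inferInstance, Subgroup.map_subtype_le _,
    S.isPGroup'.map _, ?_⟩
  intro k x hx hxk
  have h1 : (⟨x, hx⟩ : K) ^ p ^ k = 1 := Subtype.ext (by simpa using hxk)
  obtain ⟨Q, hQ⟩ := (aux_isPGroup_zpowers h1).exists_le_sylow
  have := S.unique_of_normal hS
  have hQS : Q = S := Subsingleton.elim _ _
  subst hQS
  exact ⟨⟨x, hx⟩, hQ (Subgroup.mem_zpowers _), rfl⟩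

theorem aux_nilpotent_commute {G : Type*} [Group G] [Finite G] (hG : Group.IsNilpotent G)
    {p q k l : ℕ} (hp : p.Prime) (hq : q.Prime) (hpq : p ≠ q) {x y : G} (hx : x ^ p ^ k = 1)
    (hy : y ^ q ^ l = 1) : Commute x y := by
  have : Fact p.Prime := ⟨hp⟩
  have : Fact q.Prime := ⟨hq⟩
  obtain ⟨P, hP⟩ := (aux_isPGroup_zpowers hx).exists_le_sylow
  obtain ⟨Q, hQ⟩ := (aux_isPGroup_zpowers hy).exists_le_sylow
  exact Subgroup.commute_of_normal_of_disjoint P Q inferInstance inferInstance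
    (IsPGroup.disjoint_of_ne p q hpq (P : Subgroup G) (Q : Subgroup G)
      P.isPGroup' Q.isPGroup') x y
    (hP (Subgroup.mem_zpowers x)) (hQ (Subgroup.mem_zpowers y))

/-- splitting into `p`-part and `p'`-part -/
theorem aux_split {G : Type*} [Group G] [Finite G] {p : ℕ} (hp : p.Prime) (z : G) :
    ∃ u ∈ Subgroup.zpowers z, ∃ v ∈ Subgroup.zpowers z, z = u * v ∧ (∃ k, u ^ p ^ k = 1) ∧
      (orderOf v).Coprime p := by
  obtain ⟨k, m, hm, hz⟩ := Nat.exists_eq_pow_mul_and_not_dvd (orderOf_pos z).ne' p hp.ne_one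
  have hcop : Nat.Coprime (p ^ k) m := Nat.Coprime.pow_left k ((hp.coprime_iff_not_dvd).mpr hm)
  have hb := Nat.gcd_eq_gcd_ab (p ^ k) m
  rw [hcop] at hb
  set a := (p ^ k).gcdA m
  set b := (p ^ k).gcdB m
  have h1 : z ^ (p ^ k * m) = 1 := by rw [← hz]; exact pow_orderOf_eq_one z
  refine ⟨z ^ ((m : ℤ) * b), ⟨_, rfl⟩, z ^ (((p ^ k : ℕ) : ℤ) * a), ⟨_, rfl⟩, ?_, ⟨k, ?_⟩, ?_⟩
  · rw [← zpow_add, add_comm, ← hb]; simp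
  · rw [← zpow_natCast, ← zpow_mul]
    have : (m : ℤ) * b * ((p ^ k : ℕ) : ℤ) = ((p ^ k * m : ℕ) : ℤ) * b := by push_cast; ring
    rw [this, zpow_mul, zpow_natCast, h1, one_zpow]
  · have h2 : (z ^ (((p ^ k : ℕ) : ℤ) * a)) ^ m = 1 := by
      rw [← zpow_natCast, ← zpow_mul]
      have : ((p ^ k : ℕ) : ℤ) * a * (m : ℤ) = ((p ^ k * m : ℕ) : ℤ) * a := by push_cast; ring
      rw [this, zpow_mul, zpow_natCast, h1, one_zpow]
    exact Nat.Coprime.coprime_dvd_left (orderOf_dvd_of_pow_eq_one h2)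
      ((hp.coprime_iff_not_dvd).mpr hm).symm

theorem aux_main {G : Type*} [Group G] [Finite G] (N K : Subgroup G) [N.Normal] [K.Normal]
    (hquot : Group.IsNilpotent (G ⧸ N)) (hK : Group.IsNilpotent K)
    (hcent : ∀ n ∈ N, (∀ k ∈ K, Commute n k) → n ∈ K)
    (h1 : ∀ x ∈ K, Nat.Prime (orderOf x) → x ∈ Subgroup.center G)
    (h4 : ∀ x ∈ K, orderOf x = 4 → AuxGood x) : Group.IsNilpotent G := by
  have hact : ∀ (p q k l : ℕ) (x y : G), p.Prime → q.Prime → p ≠ q → x ∈ K → x ^ p ^ k = 1 →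
      y ^ q ^ l = 1 → Commute y x := by
    intro p q k l x y hp hq hpq hx hxk hy
    obtain ⟨O, hO, hOK, hOp, hOmem⟩ := aux_exists_core K hK hp
    exact aux_lemC hp hq hpq hOp (fun x hx => h1 x (hOK hx)) (fun x hx => h4 x (hOK hx)) hy
      (hOmem k x hx hxk)
  -- coprime commutators are in `K` and centralize `K`
  have hcomm : ∀ (p q k l : ℕ) (x y : G), p.Prime → q.Prime → p ≠ q → x ^ p ^ k = 1 →
      y ^ q ^ l = 1 → ⁅y, x⁆ ∈ K ∧ ∀ g ∈ K, Commute ⁅y, x⁆ g := by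
    intro p q k l x y hp hq hpq hx hy
    have hC : ∀ g ∈ K, Commute ⁅y, x⁆ g := by
      intro g hg
      have : g ∈ Subgroup.centralizer ({⁅y, x⁆} : Set G) := by
        apply aux_mem_of_prime_pow
        intro r m g' hr hg' hgr
        have hg'K : g' ∈ K := (Subgroup.zpowers_le.mpr hg) hg'
        rw [Subgroup.mem_centralizer_singleton_iff]
        obtain ⟨O, hO, hOK, hOp, hOmem⟩ := aux_exists_core K hK hr
        have hg'O := hOmem m g' hg'K hgr
        by_cases hrp : r = p
        · -- `y` centralizes `O`
          have hyO : ∀ w ∈ O, Commute y w := by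
            intro w hw
            obtain ⟨k', hk'⟩ := aux_pow_of_mem hOp hw
            exact hact r q k' l w y hr hq (hrp ▸ hpq) (hOK hw) hk' hy
          have e1 := (hyO (x⁻¹ * g' * x) (by
            simpa using hO.conj_mem g' hg'O x⁻¹)).eq
          have e2 := (hyO g' hg'O).eq
          rw [commutatorElement_def]
          symm
          calc y * x * y⁻¹ * x⁻¹ * g' = y * x * y⁻¹ * ((x⁻¹ * g' * x) * y) * y⁻¹ * x⁻¹ := by group
            _ = y * x * y⁻¹ * (y * (x⁻¹ * g' * x)) * y⁻¹ * x⁻¹ := by rw [e1]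
            _ = (y * g') * x * y⁻¹ * x⁻¹ := by group
            _ = g' * (y * x * y⁻¹ * x⁻¹) := by rw [e2]; group
        · have hxO : ∀ w ∈ O, Commute x w := by
            intro w hw
            obtain ⟨k', hk'⟩ := aux_pow_of_mem hOp hw
            exact hact r p k' k w x hr hp hrp (hOK hw) hk' hx
          have e1 := (hxO (y⁻¹ * g' * y) (by
            simpa using hO.conj_mem g' hg'O y⁻¹)).eq
          have e2 := ((hxO g' hg'O).inv_left).eq
          rw [commutatorElement_def]
          symm
          calc y * x * y⁻¹ * x⁻¹ * g' = y * x * y⁻¹ * (x⁻¹ * g') := by group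
            _ = y * (x * (y⁻¹ * g' * y)) * y⁻¹ * x⁻¹ := by rw [e2]; group
            _ = g' * (y * x * y⁻¹ * x⁻¹) := by rw [e1]; group
      exact (Subgroup.mem_centralizer_singleton_iff.mp this).symm
    refine ⟨hcent _ ?_ hC, hC⟩
    rw [← QuotientGroup.eq_one_iff]
    have h2 : ((⁅y, x⁆ : G) : G ⧸ N) = ⁅(y : G ⧸ N), (x : G ⧸ N)⁆ := by
      simp [commutatorElement_def]
    rw [h2, commutatorElement_eq_one_iff_commute]
    refine aux_nilpotent_commute hquot hq hp hpq.symm (k := l) (l := k) ?_ ?_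
    · rw [← QuotientGroup.mk_pow, hy]; rfl
    · rw [← QuotientGroup.mk_pow, hx]; rfl
  refine (Group.isNilpotent_of_finite_tfae.out 0 3 rfl rfl).mpr ?_
  intro p hpf S
  have hp := hpf.out
  rw [← Subgroup.normalizer_eq_top_iff]
  apply aux_all_sylow
  intro q hq
  by_cases hqp : q = p
  · subst hqp
    exact ⟨S, Subgroup.le_normalizer⟩
  refine ⟨default, ?_⟩
  intro y hyQ
  obtain ⟨l, hy⟩ := aux_pow_of_mem (Sylow.isPGroup' _) hyQ
  have hstep : ∀ x ∈ (S : Subgroup G), y * x * y⁻¹ ∈ (S : Subgroup G) := by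
    intro x hxS
    obtain ⟨k, hx⟩ := aux_pow_of_mem S.isPGroup' hxS
    obtain ⟨hzK, hzC⟩ := hcomm p q k l x y hp hq (Ne.symm hqp) hx hy
    obtain ⟨O, hO, hOK, hOp, hOmem⟩ := aux_exists_core K hK hp
    obtain ⟨u, hu, v, hv, hz, ⟨ku, huk⟩, hvp⟩ := aux_split hp ⁅y, x⁆
    have huK : u ∈ K := (Subgroup.zpowers_le.mpr hzK) hu
    have hvK : v ∈ K := (Subgroup.zpowers_le.mpr hzK) hv
    have huS : u ∈ (S : Subgroup G) := hOp.le_sylow_of_normal S (hOmem ku u huK huk)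
    have huv : Commute v u := by
      obtain ⟨i, rfl⟩ := hu
      obtain ⟨j, rfl⟩ := hv
      exact (Commute.refl _).zpow_zpow _ _
    have hvx : Commute v x := by
      have : v ∈ Subgroup.centralizer ({x} : Set G) := by
        apply aux_mem_of_prime_pow
        intro r m g hr hg hgr
        rw [Subgroup.mem_centralizer_singleton_iff]
        by_cases hrp : r = p
        · have hg1 : g = 1 := by
            have hd : orderOf g ∣ orderOf v := orderOf_dvd_of_mem_zpowers hg
            have h3 : orderOf g ∣ Nat.gcd (orderOf v) (p ^ m) :=
              Nat.dvd_gcd hd (orderOf_dvd_of_pow_eq_one (hrp ▸ hgr))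
            rw [Nat.Coprime.pow_right m hvp] at h3
            exact orderOf_eq_one_iff.mp (Nat.dvd_one.mp h3)
          rw [hg1]; simp
        · exact (hact r p m k g x hr hp hrp ((Subgroup.zpowers_le.mpr hvK) hg) hgr hx).eq.symm
      exact (Subgroup.mem_centralizer_singleton_iff.mp this)
    have hux : u * x ∈ (S : Subgroup G) := Subgroup.mul_mem _ huS hxS
    obtain ⟨k', hk'⟩ := aux_pow_of_mem S.isPGroup' hux
    have heq : y * x * y⁻¹ = v * (u * x) := by
      have : y * x * y⁻¹ = ⁅y, x⁆ * x := by rw [commutatorElement_def]; group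
      rw [this]
      conv_lhs => rw [hz, ← huv.eq]
      group
    have hcm : Commute v (u * x) := huv.mul_right hvx
    have hv1 : v = 1 := by
      have e1 : v ^ p ^ (k + k') = 1 := by
        have e2 : (v * (u * x)) ^ p ^ (k + k') = 1 := by
          rw [← heq, conj_pow, pow_add, pow_mul, hx]; simp
        rw [hcm.mul_pow] at e2
        have e3 : (u * x) ^ p ^ (k + k') = 1 := by
          rw [add_comm, pow_add, pow_mul, hk', one_pow]
        rwa [e3, mul_one] at e2
      have h3 : orderOf v ∣ Nat.gcd (orderOf v) (p ^ (k + k')) :=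
        Nat.dvd_gcd dvd_rfl (orderOf_dvd_of_pow_eq_one e1)
      rw [Nat.Coprime.pow_right _ hvp] at h3
      exact orderOf_eq_one_iff.mp (Nat.dvd_one.mp h3)
    rw [heq, hv1, one_mul]
    exact hux
  rw [Subgroup.mem_normalizer_iff]
  intro h
  refine ⟨hstep h, fun hh => ?_⟩
  have hsub : (S : Subgroup G).map (MulAut.conj y).toMonoidHom ≤ S := by
    rintro _ ⟨x, hx, rfl⟩
    exact hstep x hx
  have hcard : Nat.card ((S : Subgroup G).map (MulAut.conj y).toMonoidHom) =
      Nat.card (S : Subgroup G) :=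
    Nat.card_congr ((S : Subgroup G).equivMapOfInjective _ (MulAut.conj y).injective).symm.toEquiv
  have heq := Subgroup.eq_of_le_of_card_ge hsub hcard.ge
  have hh' : y * h * y⁻¹ ∈ (S : Subgroup G).map (MulAut.conj y).toMonoidHom := by
    rw [heq]; exact hh
  obtain ⟨x, hx, hxe⟩ := hh'
  have : x = h := by
    have : y * x * y⁻¹ = y * h * y⁻¹ := hxe
    simpa using this
  exact this ▸ hx

theorem aux_card_ne {α : Type*} [Finite α] (a : α) : Nat.card {x : α // x ≠ a} + 1 = Nat.card α := by
  classical
  rw [← Finite.card_option]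
  exact Nat.card_congr (Equiv.optionSubtypeNe a)

theorem aux_coatom_inf {H : Type*} [Group H] [Finite H] [IsSimpleGroup H]
    (hnil : ∀ K : Subgroup H, K ≠ ⊤ → Group.IsNilpotent K) (M₁ M₂ : Subgroup H)
    (h₁ : IsCoatom M₁) (h₂ : IsCoatom M₂) (hne : M₁ ≠ M₂) : M₁ ⊓ M₂ = ⊥ := by
  by_contra hbot
  let s : Set (Subgroup H) :=
    {D | D ≠ ⊥ ∧ ∃ A B : Subgroup H, IsCoatom A ∧ IsCoatom B ∧ A ≠ B ∧ D = A ⊓ B}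
  have hs : s.Nonempty := ⟨M₁ ⊓ M₂, hbot, M₁, M₂, h₁, h₂, hne, rfl⟩
  obtain ⟨D, hD⟩ := (Set.toFinite s).exists_maximal hs
  obtain ⟨hDbot, A, B, hA, hB, hAB, hDAB⟩ := hD.prop
  have hDA : D ≤ A := hDAB ▸ inf_le_left
  have hDB : D ≤ B := hDAB ▸ inf_le_right
  have hDA' : D ≠ A := by
    intro h
    have : A ≤ B := h ▸ hDB
    rcases hA.le_iff.mp this with h' | h'
    · exact hB.1 h'
    · exact hAB h'.symm
  have hDB' : D ≠ B := by
    intro h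
    have : B ≤ A := h ▸ hDA
    rcases hB.le_iff.mp this with h' | h'
    · exact hA.1 h'
    · exact hAB h'
  have hnorm : Subgroup.normalizer (D : Set H) ≠ ⊤ := by
    intro h
    rw [Subgroup.normalizer_eq_top_iff] at h
    rcases h.eq_bot_or_eq_top with h' | h'
    · exact hDbot h'
    · exact hA.1 (top_le_iff.mp (h' ▸ hDA))
  obtain ⟨M, hM, hNM⟩ := (eq_top_or_exists_le_coatom (Subgroup.normalizer (D : Set H))).resolve_left hnorm
  have hDM : D ≤ M := Subgroup.le_normalizer.trans hNM
  have claim : ∀ C : Subgroup H, IsCoatom C → D ≤ C → D ≠ C → M = C := by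
    intro C hC hDC hDC'
    by_contra hMC
    have hCn := hnil C hC.1
    have hnc := Group.normalizerCondition_of_isNilpotent (G := C)
    have hlt : D.subgroupOf C < ⊤ := by
      rw [lt_top_iff_ne_top]
      intro h
      rw [Subgroup.subgroupOf_eq_top] at h
      exact hDC' (le_antisymm hDC h)
    obtain ⟨g, hg, hgD⟩ := SetLike.exists_of_lt (hnc _ hlt)
    have hgN : (g : H) ∈ Subgroup.normalizer (D : Set H) := by
      rw [Subgroup.mem_normalizer_iff] at hg ⊢
      intro h
      constructor
      · intro hh
        exact (hg ⟨h, hDC hh⟩).mp hh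
      · intro hh
        have hhC : h ∈ C := by
          have h1 := hDC hh
          have h2 := C.mul_mem (C.mul_mem (C.inv_mem g.2) h1) g.2
          simpa [mul_assoc] using h2
        exact (hg ⟨h, hhC⟩).mpr hh
    have hgM : (g : H) ∈ M ⊓ C := ⟨hNM hgN, g.2⟩
    have hle : D ≤ M ⊓ C := le_inf hDM hDC
    have hmem : M ⊓ C ∈ s :=
      ⟨fun h => hDbot (le_bot_iff.mp (h ▸ hle)), M, C, hM, hC, hMC, rfl⟩
    exact hgD (hD.le_of_ge hmem hle hgM)
  exact hAB ((claim A hA hDA hDA').symm.trans (claim B hB hDB hDB'))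

theorem aux_simple {H : Type*} [Group H] [Finite H] [IsSimpleGroup H]
    (hnil : ∀ K : Subgroup H, K ≠ ⊤ → Group.IsNilpotent K) : ∀ a b : H, a * b = b * a := by
  by_contra hnc
  have hz : ∀ h : H, Subgroup.zpowers h ≠ ⊤ := by
    intro h hh
    apply hnc
    intro a b
    obtain ⟨i, rfl⟩ := Subgroup.mem_zpowers_iff.mp (hh ▸ Subgroup.mem_top a : a ∈ Subgroup.zpowers h)
    obtain ⟨j, rfl⟩ := Subgroup.mem_zpowers_iff.mp (hh ▸ Subgroup.mem_top b : b ∈ Subgroup.zpowers h)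
    exact ((Commute.refl h).zpow_zpow i j).eq
  have hcoat : ∀ h : H, ∃ M : Subgroup H, IsCoatom M ∧ h ∈ M := by
    intro h
    obtain ⟨M, hM, hle⟩ := (eq_top_or_exists_le_coatom (Subgroup.zpowers h)).resolve_left (hz h)
    exact ⟨M, hM, hle (Subgroup.mem_zpowers h)⟩
  obtain ⟨h₀, hh₀⟩ := exists_ne (1 : H)
  have hMbot : ∀ M : Subgroup H, IsCoatom M → M ≠ ⊥ := by
    rintro M hM rfl
    have := hM.2 (Subgroup.zpowers h₀) (by
      rw [bot_lt_iff_ne_bot]; simpa using hh₀)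
    exact hz h₀ this
  have hself : ∀ M : Subgroup H, IsCoatom M → Subgroup.normalizer (M : Set H) = M := by
    intro M hM
    rcases hM.le_iff.mp (Subgroup.le_normalizer (H := M)) with h | h
    · rw [Subgroup.normalizer_eq_top_iff] at h
      rcases h.eq_bot_or_eq_top with h' | h'
      · exact absurd h' (hMbot M hM)
      · exact absurd h' hM.1
    · exact h
  have hconjco : ∀ (M : Subgroup H) (g : H), IsCoatom M →
      IsCoatom (M.map (MulAut.conj g).toMonoidHom) := by
    intro M g hM
    exact ((MulAut.conj g).mapSubgroup.isCoatom_iff M).mpr hM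
  have hconj : ∀ (M L : Subgroup H) (g m : H), IsCoatom M → IsCoatom L → m ∈ M → m ≠ 1 →
      g * m * g⁻¹ ∈ L → M.map (MulAut.conj g).toMonoidHom = L := by
    intro M L g m hM hL hm hm1 hgm
    by_contra hne
    have h1 := aux_coatom_inf hnil _ _ (hconjco M g hM) hL hne
    have h2 : g * m * g⁻¹ ∈ M.map (MulAut.conj g).toMonoidHom ⊓ L := ⟨⟨m, hm, rfl⟩, hgm⟩
    rw [h1, Subgroup.mem_bot, conj_eq_one_iff] at h2
    exact hm1 h2
  have hconjself : ∀ (M : Subgroup H) (g m : H), IsCoatom M → m ∈ M → m ≠ 1 →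
      g * m * g⁻¹ ∈ M → g ∈ M := by
    intro M g m hM hm hm1 hgm
    have h1 := hconj M M g m hM hM hm hm1 hgm
    rw [← hself M hM, Subgroup.mem_normalizer_iff]
    intro h
    constructor
    · intro hh
      rw [← h1]; exact ⟨h, hh, rfl⟩
    · intro hh
      have hh' : g * h * g⁻¹ ∈ M.map (MulAut.conj g).toMonoidHom := by rw [h1]; exact hh
      obtain ⟨x, hx, hxe⟩ := hh'
      have h3 : g * x * g⁻¹ = g * h * g⁻¹ := hxe
      have : x = h := by simpa using h3
      exact this ▸ hx
  let f : (M : Subgroup H) → (H ⧸ M) × {m : M // m ≠ 1} → {h : H // h ≠ 1} := fun M a =>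
    ⟨a.1.out * a.2.1 * a.1.out⁻¹, by
      intro h
      rw [conj_eq_one_iff] at h
      exact a.2.2 (Subtype.ext h)⟩
  have hfinj : ∀ M : Subgroup H, IsCoatom M → Function.Injective (f M) := by
    rintro M hM ⟨a, ⟨⟨m, hm⟩, hm1⟩⟩ ⟨b, ⟨⟨m', hm'⟩, hm1'⟩⟩ hab
    have h1 : a.out * m * a.out⁻¹ = b.out * m' * b.out⁻¹ := congrArg Subtype.val hab
    have h2 : (b.out⁻¹ * a.out) * m * (b.out⁻¹ * a.out)⁻¹ = m' := by
      calc _ = b.out⁻¹ * (a.out * m * a.out⁻¹) * b.out := by group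
        _ = m' := by rw [h1]; group
    have h3 : b.out⁻¹ * a.out ∈ M := hconjself M _ m hM hm
      (fun h => hm1 (Subtype.ext h)) (h2 ▸ hm')
    have h4 : b = a := by
      rw [← QuotientGroup.out_eq' b, ← QuotientGroup.out_eq' a]
      exact QuotientGroup.eq.mpr h3
    subst h4
    have h5 : m = m' := by simpa using h1
    subst h5
    rfl
  have hcards : ∀ M : Subgroup H, IsCoatom M → ∃ m : ℕ, 1 ≤ m ∧ 2 ≤ M.index ∧
      Nat.card ((H ⧸ M) × {m : M // m ≠ 1}) = M.index * m ∧ M.index * m + M.index = Nat.card H := by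
    intro M hM
    have h1 := aux_card_ne (1 : M)
    refine ⟨Nat.card {m : M // m ≠ 1}, ?_, ?_, ?_, ?_⟩
    · have hnt := (Subgroup.nontrivial_iff_ne_bot M).mpr (hMbot M hM)
      obtain ⟨a, ha⟩ := exists_ne (1 : M)
      have : Nonempty {m : M // m ≠ 1} := ⟨⟨a, ha⟩⟩
      exact Nat.card_pos
    · have h2 : M.index ≠ 1 := by rw [ne_eq, Subgroup.index_eq_one]; exact hM.1
      have h3 : M.index ≠ 0 := Subgroup.index_ne_zero_of_finite
      omega
    · rw [Nat.card_prod]; rfl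
    · rw [← M.index_mul_card, ← h1]; ring
  obtain ⟨M, hM, -⟩ := hcoat 1
  obtain ⟨m, hm1, hi2, hMc, hMn⟩ := hcards M hM
  have hHne := aux_card_ne (1 : H)
  have hnsurj : ¬ Function.Surjective (f M) := by
    intro hs
    have := Nat.card_le_card_of_surjective _ hs
    rw [hMc] at this
    omega
  simp only [Function.Surjective, not_forall] at hnsurj
  obtain ⟨⟨h, hh1⟩, hh⟩ := hnsurj
  obtain ⟨L, hL, hhL⟩ := hcoat h
  obtain ⟨l, hl1, hj2, hLc, hLn⟩ := hcards L hL
  have hinj : Function.Injective (Sum.elim (f M) (f L)) := by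
    rw [Sum.elim_injective]
    refine ⟨hfinj M hM, hfinj L hL, ?_⟩
    rintro ⟨a, ⟨⟨x, hx⟩, hx1⟩⟩ ⟨b, ⟨⟨x', hx'⟩, hx1'⟩⟩ hab
    have h1 : a.out * x * a.out⁻¹ = b.out * x' * b.out⁻¹ := congrArg Subtype.val hab
    have h2 : (b.out⁻¹ * a.out) * x * (b.out⁻¹ * a.out)⁻¹ = x' := by
      calc _ = b.out⁻¹ * (a.out * x * a.out⁻¹) * b.out := by group
        _ = x' := by rw [h1]; group
    have h3 := hconj M L _ x hM hL hx (fun h => hx1 (Subtype.ext h)) (h2 ▸ hx')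
    rw [← h3] at hhL
    obtain ⟨y, hy, hyh⟩ := hhL
    set g := b.out⁻¹ * a.out
    have hyh' : g * y * g⁻¹ = h := hyh
    apply hh
    obtain ⟨w, hw⟩ := QuotientGroup.mk_out_eq_mul M g
    refine ⟨⟨(g : H ⧸ M), ⟨⟨(w : H)⁻¹ * y * w, M.mul_mem (M.mul_mem (M.inv_mem w.2) hy) w.2⟩, ?_⟩⟩, ?_⟩
    · intro h5
      have h6 : (w : H)⁻¹ * y * w = 1 := congrArg Subtype.val h5
      have h7 : y = 1 := by
        have : y = w * ((w : H)⁻¹ * y * w) * (w : H)⁻¹ := by group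
        rw [this, h6]; group
      apply hh1
      rw [← hyh', h7]; group
    · apply Subtype.ext
      change (Quotient.out (g : H ⧸ M)) * ((w : H)⁻¹ * y * w) * (Quotient.out (g : H ⧸ M))⁻¹ = h
      rw [hw, ← hyh']; group
  have hle := Nat.card_le_card_of_injective _ hinj
  rw [Nat.card_sum, hMc, hLc] at hle
  have e1 : M.index ≤ M.index * m := Nat.le_mul_of_pos_right _ hm1
  have e2 : L.index ≤ L.index * l := Nat.le_mul_of_pos_right _ hl1
  omega

theorem aux_schmidt : ∀ (n : ℕ) (H : Type*) [Group H] [Finite H], Nat.card H = n →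
    (∀ K : Subgroup H, K ≠ ⊤ → Group.IsNilpotent K) → Group.IsSolvable H := by
  intro n
  induction n using Nat.strong_induction_on with
  | _ n ih =>
  intro H _ _ hn hnil
  rcases subsingleton_or_nontrivial H with hs | hnt
  · infer_instance
  by_cases hsimp : IsSimpleGroup H
  · exact Group.isSolvable_of_comm (aux_simple hnil)
  have : ∃ M : Subgroup H, M.Normal ∧ M ≠ ⊥ ∧ M ≠ ⊤ := by
    by_contra hcon
    push Not at hcon
    exact hsimp ⟨fun M hM => or_iff_not_imp_left.mpr (hcon M hM)⟩
  obtain ⟨M, hM, hMb, hMt⟩ := this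
  have hMn := hnil M hMt
  have hq : Group.IsSolvable (H ⧸ M) := by
    refine ih _ ?_ (H ⧸ M) rfl ?_
    · rw [← hn, ← M.card_mul_index]
      have h1 : 1 < Nat.card M := by
        rw [Subgroup.one_lt_card_iff_ne_bot]; exact hMb
      have h2 : 0 < M.index := Nat.pos_of_ne_zero Subgroup.index_ne_zero_of_finite
      change M.index < _
      nlinarith
    · intro K hK
      have hK' : K.comap (QuotientGroup.mk' M) ≠ ⊤ := by
        intro h
        apply hK
        rw [eq_top_iff]
        intro x _
        obtain ⟨y, rfl⟩ := QuotientGroup.mk'_surjective M x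
        have : y ∈ K.comap (QuotientGroup.mk' M) := by rw [h]; trivial
        exact this
      have := hnil _ hK'
      exact Group.nilpotent_of_surjective ((QuotientGroup.mk' M).subgroupComap K)
        ((QuotientGroup.mk' M).subgroupComap_surjective_of_surjective K
          (QuotientGroup.mk'_surjective M))
  exact (Group.isSolvable_iff_subgroup_quotient M).mpr ⟨inferInstance, hq⟩

/-- A subgroup-closed version of the hypotheses. -/
def AuxP (H : Type*) [Group H] : Prop :=
  (∀ x : H, Nat.Prime (orderOf x) → x ∈ Subgroup.center H) ∧ ∀ x : H, orderOf x = 4 → AuxGood x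

theorem aux_good_subgroup {G : Type*} [Group G] (K : Subgroup G) (x : K)
    (h : AuxGood (x : G)) : AuxGood x := by
  rcases h with hs | ⟨T, hT, hxT⟩
  · left
    intro p hp Q
    obtain ⟨S, hS⟩ := Q.exists_comap_subtype_eq
    have hs' := hs p hp S
    have hQS : ∀ g : K, g ∈ (Q : Subgroup K) ↔ (g : G) ∈ (S : Subgroup G) := by
      intro g
      rw [← hS]; rfl
    ext g
    constructor
    · rintro ⟨a, ha, b, hb, rfl⟩
      obtain ⟨i, rfl⟩ := ha
      have h1 : ((x : G) ^ i) * (b : G) ∈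
          ((S : Subgroup G) : Set G) * (Subgroup.zpowers (x : G) : Set G) := by
        rw [← hs']
        exact Set.mul_mem_mul ⟨i, rfl⟩ ((hQS b).mp hb)
      obtain ⟨c, hc, d, ⟨j, rfl⟩, hcd⟩ := Set.mem_mul.mp h1
      refine ⟨x ^ i * b * (x ^ j)⁻¹, ?_, x ^ j, ⟨j, rfl⟩, by simp⟩
      rw [SetLike.mem_coe, hQS]
      have : ((x ^ i * b * (x ^ j)⁻¹ : K) : G) = c := by
        push_cast
        rw [← hcd]; simp
      rw [this]; exact hc
    · rintro ⟨b, hb, a, ⟨i, rfl⟩, rfl⟩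
      have h1 : (b : G) * ((x : G) ^ i) ∈
          (Subgroup.zpowers (x : G) : Set G) * ((S : Subgroup G) : Set G) := by
        rw [hs']
        exact Set.mul_mem_mul ((hQS b).mp hb) ⟨i, rfl⟩
      obtain ⟨d, ⟨j, rfl⟩, c, hc, hcd⟩ := Set.mem_mul.mp h1
      refine ⟨x ^ j, ⟨j, rfl⟩, (x ^ j)⁻¹ * (b * x ^ i), ?_, by simp⟩
      rw [SetLike.mem_coe, hQS]
      have : (((x ^ j)⁻¹ * (b * x ^ i) : K) : G) = c := by
        push_cast
        rw [← hcd]; simp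
      rw [this]; exact hc
  · right
    refine ⟨T.subgroupOf K, ?_, fun h => hxT h⟩
    have hTn : T.Normal := Subgroup.normal_of_index_eq_two hT
    have h1 : (T.subgroupOf K).index ∣ T.index := Subgroup.relIndex_dvd_index_of_normal T K
    rw [hT] at h1
    rcases (Nat.dvd_prime Nat.prime_two).mp h1 with h2 | h2
    · rw [Subgroup.index_eq_one] at h2
      exact absurd (show x ∈ T.subgroupOf K by rw [h2]; trivial) (fun h => hxT h)
    · exact h2

theorem aux_P_subgroup {G : Type*} [Group G] (K : Subgroup G) (h : AuxP G) : AuxP K := by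
  refine ⟨fun x hx => ?_, fun x hx => ?_⟩
  · have := h.1 (x : G) (by rwa [Subgroup.orderOf_coe])
    rw [Subgroup.mem_center_iff] at this ⊢
    intro g
    exact Subtype.ext (this g)
  · exact aux_good_subgroup K x (h.2 (x : G) (by rwa [Subgroup.orderOf_coe]))

theorem aux_thmA : ∀ (n : ℕ) (H : Type*) [Group H] [Finite H], Nat.card H = n →
    AuxP H → Group.IsNilpotent H := by
  intro n
  induction n using Nat.strong_induction_on with
  | _ n ih =>
  intro H _ _ hn hP
  rcases subsingleton_or_nontrivial H with hs | hnt
  · infer_instance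
  have hnil : ∀ K : Subgroup H, K ≠ ⊤ → Group.IsNilpotent K := by
    intro K hK
    refine ih (Nat.card K) ?_ K rfl (aux_P_subgroup K hP)
    rw [← hn]
    refine lt_of_le_of_ne (Subgroup.card_le_card_group K) ?_
    intro h
    exact hK (Subgroup.eq_top_of_card_eq K h)
  have hsol := aux_schmidt n H hn hnil
  have hlt : commutator H < ⊤ := Group.IsSolvable.commutator_lt_top_of_nontrivial H
  have hab : Group.IsNilpotent (H ⧸ commutator H) :=
    inferInstanceAs (Group.IsNilpotent (Abelianization H))
  exact aux_main (commutator H) (commutator H) hab (hnil _ hlt.ne) (fun n hn _ => hn)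
    (fun x _ => hP.1 x) (fun x _ => hP.2 x)

theorem aux_convert {G : Type*} [Group G] {x : G} (hx : orderOf x = 4)
    (hc : x ^ 2 ∈ Subgroup.center G) (h : WeaklySPhiSupplemented (Subgroup.zpowers x)) :
    AuxGood x := by
  by_cases hs : IsSPermutable (Subgroup.zpowers x)
  · exact Or.inl hs
  right
  obtain ⟨T, hT, hle⟩ := h
  set Z := Subgroup.zpowers (x ^ 2) with hZ
  have hZn : Z.Normal := by
    refine ⟨fun n hn g => ?_⟩
    have : n ∈ Subgroup.center G := (Subgroup.zpowers_le.mpr hc) hn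
    rw [(Subgroup.mem_center_iff.mp this g), mul_inv_cancel_right]
    exact hn
  have hx4 : x ^ (4 : ℤ) = 1 := by
    have := pow_orderOf_eq_one x
    rw [hx] at this
    exact_mod_cast this
  have hxZ : x ∉ Z := by
    intro hxZ
    obtain ⟨j, hj⟩ := Subgroup.mem_zpowers_iff.mp hxZ
    have h1 : x ^ (2 * j - 1) = 1 := by
      rw [zpow_sub, zpow_mul, zpow_one]
      have : x ^ (2 : ℤ) = x ^ 2 := by norm_cast
      rw [this, hj, mul_inv_cancel]
    have h2 := orderOf_dvd_iff_zpow_eq_one.mpr h1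
    rw [hx] at h2
    omega
  have hev : ∀ j : ℤ, x ^ (2 * j) ∈ Z := by
    intro j
    refine Subgroup.mem_zpowers_iff.mpr ⟨j, ?_⟩
    rw [zpow_mul]
    norm_cast
  have hdich : ∀ y ∈ Subgroup.zpowers x, y ∈ Z ∨ x ∈ Subgroup.zpowers y := by
    intro y hy
    obtain ⟨i, rfl⟩ := Subgroup.mem_zpowers_iff.mp hy
    rcases Int.even_or_odd' i with ⟨j, hj | hj⟩
    · left; rw [hj]; exact hev j
    · right
      refine Subgroup.mem_zpowers_iff.mpr ⟨i, ?_⟩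
      rw [← zpow_mul, hj]
      have : (2 * j + 1) * (2 * j + 1) = 4 * (j * j + j) + 1 := by ring
      rw [this, zpow_add, zpow_mul, hx4]
      simp
  have hcore : sCore (Subgroup.zpowers x) ≤ Z := by
    refine iSup₂_le ?_
    rintro B ⟨hB, hBs⟩ y hy
    rcases hdich y (hB hy) with h1 | h1
    · exact h1
    · exfalso
      apply hs
      have : B = Subgroup.zpowers x := le_antisymm hB
        (Subgroup.zpowers_le.mpr ((Subgroup.zpowers_le.mpr hy) h1))
      rwa [← this]
  have hfr : (frattini (Subgroup.zpowers x)).map (Subgroup.zpowers x).subtype ≤ Z := by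
    have hco : IsCoatom (Z.subgroupOf (Subgroup.zpowers x)) := by
      constructor
      · intro htop
        apply hxZ
        have h1 : (⟨x, Subgroup.mem_zpowers x⟩ : Subgroup.zpowers x) ∈
          Z.subgroupOf (Subgroup.zpowers x) := by rw [htop]; trivial
        exact h1
      · intro L hL
        obtain ⟨-, y, hyL, hyZ⟩ := SetLike.lt_iff_le_and_exists.mp hL
        have h1 : x ∈ Subgroup.zpowers (y : G) := (hdich y y.2).resolve_left hyZ
        rw [eq_top_iff]
        rintro ⟨w, hw⟩ -
        have h2 : w ∈ Subgroup.zpowers (y : G) := (Subgroup.zpowers_le.mpr h1) hw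
        obtain ⟨i, hi⟩ := Subgroup.mem_zpowers_iff.mp h2
        have h3 := L.zpow_mem hyL i
        convert h3 using 1
        exact Subtype.ext hi.symm
    rw [Subgroup.map_le_iff_le_comap]
    exact frattini_le_coatom hco
  have hAT : Subgroup.zpowers x ⊓ T ≤ Z := hle.trans (sup_le hfr hcore)
  have hZA : Z ≤ Subgroup.zpowers x :=
    Subgroup.zpowers_le.mpr ((Subgroup.zpowers x).pow_mem (Subgroup.mem_zpowers x) 2)
  have hxT : x ∉ T ⊔ Z := by
    intro h1
    obtain ⟨t, ht, z, hz, htz⟩ := Subgroup.mem_sup_of_normal_right.mp h1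
    have h2 : t = x * z⁻¹ := by rw [← htz]; group
    have h3 : t ∈ Z := hAT (Subgroup.mem_inf.mpr ⟨by
      rw [h2]; exact mul_mem (Subgroup.mem_zpowers x) (inv_mem (hZA hz)), ht⟩)
    exact hxZ (htz ▸ mul_mem h3 hz)
  refine ⟨T ⊔ Z, ?_, hxT⟩
  rw [Subgroup.index_eq_two_iff_exists_notMem_and']
  refine ⟨x⁻¹, fun h1 => hxT (by simpa using h1), fun g => ?_⟩
  have hg : g ∈ ((Subgroup.zpowers x : Set G) * (T : Set G)) := by rw [hT]; trivial
  obtain ⟨a, ha, t, ht, rfl⟩ := Set.mem_mul.mp hg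
  obtain ⟨i, rfl⟩ := Subgroup.mem_zpowers_iff.mp ha
  have hTm : t ∈ T ⊔ Z := (le_sup_left : T ≤ T ⊔ Z) ht
  have hZm : ∀ j : ℤ, x ^ (2 * j) ∈ T ⊔ Z := fun j => (le_sup_right : Z ≤ T ⊔ Z) (hev j)
  rcases Int.even_or_odd' i with ⟨j, hj | hj⟩
  · right; rw [hj]; exact mul_mem (hZm j) hTm
  · left
    have : x⁻¹ * (x ^ i * t) = x ^ (2 * j) * t := by rw [hj, zpow_add]; group
    rw [this]; exact mul_mem (hZm j) hTm

theorem aux_subnormal_iff {G : Type*} [Group G] (H : Subgroup G) :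
    IsSubnormalSubgroup H ↔ H.IsSubnormal := by
  constructor
  · rintro ⟨n, s, h0, hn, hs⟩
    have key : ∀ i : Fin (n + 1), (s i).IsSubnormal := by
      intro i
      induction i using Fin.reverseInduction with
      | last => rw [hn]; exact Subgroup.IsSubnormal.top
      | cast i ih => exact Subgroup.IsSubnormal.step _ _ (hs i).1 ih (hs i).2
    rw [← h0]; exact key 0
  · intro h
    rw [Subgroup.IsSubnormal.isSubnormal_iff] at h
    obtain ⟨n, f, hm, hf, h0, hn⟩ := h
    refine ⟨n, fun i => f i, by simpa using h0, by simpa using hn, fun i => ⟨?_, ?_⟩⟩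
    · exact hm (by simp)
    · simpa using hf i

theorem aux_quasi_equiv {A B : Type*} [Group A] [Group B] (e : A ≃* B) (h : IsQuasisimple A) :
    IsQuasisimple B := by
  obtain ⟨h1, h2⟩ := h
  have hsurj : Function.Surjective e.toMonoidHom := e.surjective
  have hc : (Subgroup.center A).map e.toMonoidHom = Subgroup.center B := by
    ext b
    constructor
    · rintro ⟨a, ha, rfl⟩
      rw [Subgroup.mem_center_iff]
      intro g
      obtain ⟨c, rfl⟩ := hsurj g
      rw [← map_mul, ← map_mul, Subgroup.mem_center_iff.mp ha c]
    · intro hb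
      refine ⟨e.symm b, ?_, e.apply_symm_apply b⟩
      refine Subgroup.mem_center_iff.mpr fun g => e.injective ?_
      simp only [map_mul, MulEquiv.apply_symm_apply]
      exact Subgroup.mem_center_iff.mp hb (e g)
  constructor
  · have : (commutator A).map e.toMonoidHom = commutator B := by
      rw [commutator_def, commutator_def, Subgroup.map_commutator,
        Subgroup.map_top_of_surjective _ hsurj]
    rw [← this, h1, Subgroup.map_top_of_surjective _ hsurj]
  · have e' : A ⧸ Subgroup.center A ≃* B ⧸ Subgroup.center B :=
      QuotientGroup.congr _ _ e hc
    have := e'.symm.toEquiv.nontrivial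
    exact IsSimpleGroup.isSimpleGroup_of_surjective e'.toMonoidHom e'.surjective

theorem aux_layer_char (G : Type*) [Group G] : (layer G).Characteristic := by
  rw [Subgroup.characteristic_iff_map_le]
  intro φ
  rw [layer, Subgroup.map_iSup]
  refine iSup_le fun C => ?_
  rw [Subgroup.map_iSup]
  refine iSup_le fun hC => ?_
  refine le_iSup₂_of_le (C.map φ.toMonoidHom) ?_ le_rfl
  refine ⟨?_, ?_⟩
  · rw [aux_subnormal_iff]
    exact ((aux_subnormal_iff C).mp hC.1).map φ.surjective
  · exact aux_quasi_equiv (φ.subgroupMap C) hC.2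

theorem aux_fitting_char (G : Type*) [Group G] : (fittingSubgroup G).Characteristic := by
  rw [Subgroup.characteristic_iff_map_le]
  intro φ
  rw [fittingSubgroup, Subgroup.map_iSup]
  refine iSup_le fun C => ?_
  rw [Subgroup.map_iSup]
  refine iSup_le fun hC => ?_
  refine le_iSup₂_of_le (C.map φ.toMonoidHom) ?_ le_rfl
  refine ⟨hC.1.map _ φ.surjective, ?_⟩
  have := hC.2
  exact Group.nilpotent_of_mulEquiv (φ.subgroupMap C)

theorem aux_genFitting_char (G : Type*) [Group G] : (genFitting G).Characteristic := by
  rw [Subgroup.characteristic_iff_map_le]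
  intro φ
  have h1 := Subgroup.characteristic_iff_map_le.mp (aux_layer_char G) φ
  have h2 := Subgroup.characteristic_iff_map_le.mp (aux_fitting_char G) φ
  rw [genFitting, Subgroup.map_sup]
  exact sup_le_sup h1 h2

theorem aux_subnormal_pgroup {G : Type*} [Group G] [Finite G] {p : ℕ} {S : Subgroup G}
    (hS : S.IsSubnormal) : ∀ X : Subgroup G, X ≤ S → S ≤ Subgroup.normalizer (X : Set G) →
      IsPGroup p X → ∃ O : Subgroup G, O.Normal ∧ IsPGroup p O ∧ X ≤ O := by
  induction hS with
  | top =>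
    intro X _ hX hp
    exact ⟨X, Subgroup.normalizer_eq_top_iff.mp (top_le_iff.mp hX), hp, le_rfl⟩
  | step S K hSK hK hN ih =>
    intro X hXS hX hp
    let A : Set (Subgroup G) := {Y | Y ≤ S ∧ S ≤ Subgroup.normalizer (Y : Set G) ∧ IsPGroup p Y}
    have hXA : X ∈ A := ⟨hXS, hX, hp⟩
    obtain ⟨Y, hXY, hY⟩ := (Set.toFinite A).exists_le_maximal hXA
    have hmax : ∀ Z ∈ A, Z ≤ Y := by
      intro Z hZ
      have h1 : Y ⊔ Z ∈ A := by
        refine ⟨sup_le hY.1.1 hZ.1, ?_, ?_⟩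
        · intro s hs
          have h1 := hY.1.2.1 hs
          have h2 := hZ.2.1 hs
          rw [Subgroup.mem_normalizer_iff_map_conj_eq] at *
          rw [Subgroup.map_sup, h1, h2]
        · exact hY.1.2.2.to_sup_of_normal_right' hZ.2.2 (hY.1.1.trans hZ.2.1)
      exact le_sup_right.trans (hY.2 h1 le_sup_left)
    have hSN := (Subgroup.normal_subgroupOf_iff_le_normalizer hSK).mp hN
    have hconj : ∀ k ∈ K, Y.map (MulAut.conj k).toMonoidHom ≤ Y := by
      intro k hk
      have hkS := hSN hk
      apply hmax
      refine ⟨?_, ?_, hY.1.2.2.map _⟩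
      · rintro _ ⟨y, hy, rfl⟩
        exact (Subgroup.mem_normalizer_iff.mp hkS y).mp (hY.1.1 hy)
      · intro s hs
        have hs' : k⁻¹ * s * k ∈ S := by
          rw [Subgroup.mem_normalizer_iff.mp hkS]
          convert hs using 1
          group
        have h1 := hY.1.2.1 hs'
        rw [Subgroup.mem_normalizer_iff] at h1 ⊢
        have h3 : ∀ h : G, h ∈ Y.map (MulAut.conj k).toMonoidHom ↔ k⁻¹ * h * k ∈ Y := by
          intro h
          constructor
          · rintro ⟨y, hy, rfl⟩
            convert hy using 1
            simp [mul_assoc]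
          · intro h4
            exact ⟨_, h4, by simp [mul_assoc]⟩
        intro h
        change h ∈ Y.map (MulAut.conj k).toMonoidHom ↔
          s * h * s⁻¹ ∈ Y.map (MulAut.conj k).toMonoidHom
        rw [h3, h3]
        have h5 := h1 (k⁻¹ * h * k)
        have h6 : k⁻¹ * s * k * (k⁻¹ * h * k) * (k⁻¹ * s * k)⁻¹ = k⁻¹ * (s * h * s⁻¹) * k := by
          group
        rw [h6] at h5
        exact h5
    have hKY : K ≤ Subgroup.normalizer (Y : Set G) := by
      intro k hk
      rw [Subgroup.mem_normalizer_iff]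
      intro h
      constructor
      · intro hh
        exact hconj k hk ⟨h, hh, rfl⟩
      · intro hh
        have := hconj k⁻¹ (inv_mem hk) ⟨_, hh, rfl⟩
        simpa [mul_assoc] using this
    obtain ⟨O, hO, hOp, hle⟩ := ih Y (hY.1.1.trans hSK) hKY hY.1.2.2
    exact ⟨O, hO, hOp, hXY.trans hle⟩

theorem aux_subnormal_nilpotent {G : Type*} [Group G] [Finite G] {S : Subgroup G}
    (hS : S.IsSubnormal) (hn : Group.IsNilpotent S) : S ≤ fittingSubgroup G := by
  have key : (fittingSubgroup G).subgroupOf S = ⊤ := by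
    refine aux_all_prime_pow _ fun r k g hr hg => ?_
    have hn' : Group.IsNilpotent (⊤ : Subgroup S) := inferInstance
    obtain ⟨O, hO, -, hOp, hOm⟩ := aux_exists_core (⊤ : Subgroup S) hn' hr
    obtain ⟨P, hP, hPp, hle⟩ := aux_subnormal_pgroup hS (O.map S.subtype)
      (Subgroup.map_subtype_le O) (by
        have h1 : ((O.map S.subtype).subgroupOf S).Normal := by
          rw [← Subgroup.comap_subtype, Subgroup.comap_map_eq_self_of_injective S.subtype_injective]
          exact hO
        exact (Subgroup.normal_subgroupOf_iff_le_normalizer (Subgroup.map_subtype_le O)).mp h1)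
      (hOp.map _)
    have hgP : (g : G) ∈ P := hle ⟨g, hOm k g trivial hg, rfl⟩
    have : Fact r.Prime := ⟨hr⟩
    have hPn : Group.IsNilpotent P := hPp.isNilpotent
    have : P ≤ fittingSubgroup G := le_iSup₂_of_le P ⟨hP, hPn⟩ le_rfl
    exact this hgP
  exact Subgroup.subgroupOf_eq_top.mp key

theorem aux_bender {G : Type*} [Group G] [Finite G] :
    Subgroup.centralizer (genFitting G : Set G) ≤ genFitting G := by
  by_contra hcon
  have hch := aux_genFitting_char G
  set F := genFitting G with hF
  set C := Subgroup.centralizer (F : Set G) with hC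
  have hCn : C.Normal := inferInstance
  let A : Set (Subgroup G) := {S | S.IsSubnormal ∧ S ≤ C ∧ ¬ S ≤ F}
  obtain ⟨S, -, hSm⟩ := (Set.toFinite A).exists_le_minimal
    (show C ∈ A from ⟨hCn.isSubnormal, le_rfl, hcon⟩)
  obtain ⟨hSs, hSC, hSF⟩ := hSm.1
  have hkey : ∀ M : Subgroup S, M.Normal → M ≠ ⊤ → M ≤ Subgroup.center S := by
    intro M hM hMt
    have h1 : (M.map S.subtype).IsSubnormal := hM.isSubnormal.trans' hSs
    have h2 : M.map S.subtype ≤ F := by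
      by_contra h3
      have h4 := hSm.2 (show M.map S.subtype ∈ A from
        ⟨h1, (Subgroup.map_subtype_le M).trans hSC, h3⟩) (Subgroup.map_subtype_le M)
      apply hMt
      rw [eq_top_iff]
      intro s _
      obtain ⟨m, hm, hms⟩ := h4 s.2
      have : m = s := Subtype.ext hms
      exact this ▸ hm
    intro m hm
    refine Subgroup.mem_center_iff.mpr fun g => ?_
    have h5 : (m : G) ∈ F := h2 ⟨m, hm, rfl⟩
    have h6 := Subgroup.mem_centralizer_iff.mp (hSC g.2) m h5
    exact Subtype.ext h6.symm
  by_cases hperf : commutator S = ⊤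
  · have hct : Subgroup.center S ≠ ⊤ := by
      intro h
      apply hSF
      have h1 : commutator S ≤ ⊥ := by
        rw [commutator_def, Subgroup.commutator_le]
        intro a _ b _
        rw [Subgroup.mem_bot, commutatorElement_eq_one_iff_mul_comm]
        have : b ∈ Subgroup.center S := by rw [h]; trivial
        exact Subgroup.mem_center_iff.mp this a
      rw [hperf] at h1
      intro s hs
      have h2 := h1 (Subgroup.mem_top (⟨s, hs⟩ : S))
      rw [Subgroup.mem_bot] at h2
      have : s = 1 := congrArg Subtype.val h2
      rw [this]; exact one_mem _
    have hq : IsQuasisimple S := by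
      refine ⟨hperf, ?_⟩
      have hnt : Nontrivial (S ⧸ Subgroup.center S) := QuotientGroup.nontrivial_iff.mpr hct
      refine ⟨fun M hM => ?_⟩
      by_cases hMt : M.comap (QuotientGroup.mk' (Subgroup.center S)) = ⊤
      · right
        rw [eq_top_iff]
        intro x _
        obtain ⟨s, rfl⟩ := QuotientGroup.mk'_surjective _ x
        have : s ∈ M.comap (QuotientGroup.mk' (Subgroup.center S)) := by rw [hMt]; trivial
        exact this
      · left
        have h1 := hkey _ (hM.comap _) hMt
        rw [eq_bot_iff]
        intro x hx
        obtain ⟨s, rfl⟩ := QuotientGroup.mk'_surjective _ x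
        have : s ∈ Subgroup.center S := h1 hx
        rw [Subgroup.mem_bot]
        exact (QuotientGroup.eq_one_iff s).mpr this
    apply hSF
    have : S ≤ layer G := le_iSup₂_of_le S ⟨(aux_subnormal_iff S).mpr hSs, hq⟩ le_rfl
    exact this.trans le_sup_left
  · have h1 := hkey (commutator S) inferInstance hperf
    have hn : Group.IsNilpotent S := by
      have hq : Group.IsNilpotent (Abelianization S) := inferInstance
      refine Subgroup.isNilpotent_of_ker_le_center (Abelianization.of (G := S)) ?_
      rw [Abelianization.ker_of]
      exact h1
    exact hSF ((aux_subnormal_nilpotent hSs hn).trans le_sup_right)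

theorem stmt6 {G : Type*} [Group G] [Finite G] (N : Subgroup G) [N.Normal]
    (hquot : Group.IsNilpotent (G ⧸ N))
    (hmin : ∀ x : G, x ∈ (genFitting N).map N.subtype → Nat.Prime (orderOf x) →
      x ∈ Subgroup.center G)
    (h4 : ∀ x : G, x ∈ (genFitting N).map N.subtype → orderOf x = 4 →
      WeaklySPhiSupplemented (Subgroup.zpowers x)) :
    Group.IsNilpotent G := by
  have hch := aux_genFitting_char N
  have hKn : ((genFitting N).map N.subtype).Normal := inferInstance
  set K := (genFitting N).map N.subtype with hK
  have hgood : ∀ x ∈ K, orderOf x = 4 → AuxGood x := by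
    intro x hx hx4
    refine aux_convert hx4 (hmin _ (pow_mem hx 2) ?_) (h4 x hx hx4)
    rw [orderOf_pow, hx4]
    norm_num
  have hKnil : Group.IsNilpotent K := by
    refine aux_thmA _ K rfl ⟨fun x hx => ?_, fun x hx => ?_⟩
    · rw [← Subgroup.orderOf_coe] at hx
      have h1 := hmin x x.2 hx
      exact Subgroup.mem_center_iff.mpr fun g => Subtype.ext (Subgroup.mem_center_iff.mp h1 g)
    · rw [← Subgroup.orderOf_coe] at hx
      exact aux_good_subgroup K x (hgood x x.2 hx)
  refine aux_main N K hquot hKnil ?_ hmin hgood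
  intro n hn hcomm
  have h1 : (⟨n, hn⟩ : N) ∈ Subgroup.centralizer (genFitting N : Set N) := by
    rw [Subgroup.mem_centralizer_iff]
    intro f hf
    exact Subtype.ext (hcomm f ⟨f, hf, rfl⟩).eq.symm
  exact ⟨_, aux_bender h1, rfl⟩
end

section
/- Let G be a finite group and S a Sylow p-subgroup of G, where p is the smallest prime divisor of |G|. If exp(S) = p and every subgroup of S of order p is weakly SΦ-supplemented in G, then G is p-nilpotent. -/
open scoped Pointwise

theorem pelt_mem_sylow {G : Type*} [Group G] {p k : ℕ} {x : G} (hx : x ^ p ^ k = 1) :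
    ∃ P : Sylow p G, x ∈ P := by
  have h : IsPGroup p (Subgroup.zpowers x) := by
    rw [isPGroup_iff_pow_pow_eq_one]
    rintro ⟨y, hy⟩
    obtain ⟨n, rfl⟩ := Subgroup.mem_zpowers_iff.1 hy
    refine ⟨k, Subtype.ext ?_⟩
    simp only [Subgroup.coe_pow, Subgroup.coe_one]
    rw [← zpow_natCast, ← zpow_mul, mul_comm, zpow_mul, zpow_natCast, hx, one_zpow]
  obtain ⟨P, hP⟩ := h.exists_le_sylow
  exact ⟨P, hP (Subgroup.mem_zpowers x)⟩

theorem sylow_pelt {G : Type*} [Group G] {p : ℕ} (P : Sylow p G) {x : G} (hx : x ∈ P) :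
    ∃ k, x ^ p ^ k = 1 := by
  obtain ⟨k, hk⟩ := isPGroup_iff_pow_pow_eq_one.1 P.isPGroup' ⟨x, hx⟩
  exact ⟨k, by simpa using congrArg Subtype.val hk⟩

/-- Every `p`-element normalizes every Sylow `q`-subgroup for primes `q ≠ p`. -/
def Nrm (p : ℕ) (G : Type*) [Group G] : Prop :=
  ∀ x : G, ∀ k : ℕ, x ^ p ^ k = 1 → ∀ q : ℕ, q.Prime → q ≠ p → ∀ Q : Sylow q G,
    ∀ y ∈ Q, x * y * x⁻¹ ∈ Q

theorem Nrm.le_normalizer {G : Type*} [Group G] {p : ℕ} (h : Nrm p G)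
    {q : ℕ} (hq : q.Prime) (hqp : q ≠ p) (Q : Sylow q G) :
    Subgroup.normalClosure {x : G | ∃ k : ℕ, x ^ p ^ k = 1} ≤
      Subgroup.normalizer ((Q : Subgroup G) : Set G) := by
  refine (Subgroup.closure_le _).2 ?_
  intro y hy
  obtain ⟨x, ⟨k, hk⟩, hxy⟩ := Group.mem_conjugatesOfSet_iff.1 hy
  obtain ⟨g, rfl⟩ := isConj_iff.1 hxy
  have h1 : (g * x * g⁻¹) ^ p ^ k = 1 := by rw [conj_pow, hk]; simp
  have h2 : ((g * x * g⁻¹)⁻¹) ^ p ^ k = 1 := by rw [inv_pow, h1]; simp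
  refine Subgroup.mem_normalizer_iff.2 fun z => ⟨h _ k h1 q hq hqp Q z, fun hz => ?_⟩
  have := h _ k h2 q hq hqp Q _ hz
  have h5 : z ∈ Q := by simpa [mul_assoc] using this
  exact h5

/-- A finite group where a normal Sylow `p`-subgroup commutes with all `q`-Sylows. -/
theorem pnil_of_normal {G : Type*} [Group G] [Finite G] {p : ℕ} (hp : p.Prime)
    (S : Sylow p G) (hS : (S : Subgroup G).Normal)
    (hc : ∀ q : ℕ, q.Prime → q ≠ p → ∀ Q : Sylow q G, (Q : Subgroup G) ≤
      Subgroup.centralizer ((S : Subgroup G) : Set G)) : IsPNilpotent p G := by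
  have := Fact.mk hp
  obtain ⟨n, hn⟩ := IsPGroup.iff_card.1 S.isPGroup'
  have hcop : Nat.Coprime (Nat.card (S : Subgroup G)) (S : Subgroup G).index := by
    rw [hn]
    exact ((hp.coprime_iff_not_dvd).2 S.not_dvd_index).pow_left n
  obtain ⟨T, hT⟩ := Subgroup.exists_right_complement'_of_coprime hcop
  have hTc : Nat.card T = (S : Subgroup G).index := hT.symm.index_eq_card.symm
  set C := Subgroup.centralizer ((S : Subgroup G) : Set G) with hC
  have : C.Normal := by rw [hC]; infer_instance
  have hTC : T ≤ C := by
    rw [← Subgroup.relIndex_eq_one]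
    by_contra hne
    obtain ⟨q, hq, hqd⟩ := Nat.exists_prime_and_dvd hne
    have := Fact.mk hq
    have h1 : q ∣ Nat.card T := hqd.trans (Subgroup.relIndex_dvd_card _ _)
    have h2 : q ∣ C.index := hqd.trans (Subgroup.relIndex_dvd_index_of_normal _ _)
    have hqp : q ≠ p := by
      rintro rfl
      exact S.not_dvd_index (hTc ▸ h1)
    obtain ⟨Q⟩ : Nonempty (Sylow q G) := inferInstance
    exact Q.not_dvd_index (h2.trans (Subgroup.index_dvd_of_le (hc q hq hqp Q)))
  refine ⟨T, ?_, ⟨n, ?_⟩, ?_⟩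
  · rw [← Subgroup.normalizer_eq_top_iff, ← top_le_iff, ← hT.sup_eq_top]
    refine sup_le ?_ Subgroup.le_normalizer
    intro s hs
    refine Subgroup.mem_normalizer_iff.2 fun z => ⟨fun hz => ?_, fun hz => ?_⟩
    · have := Subgroup.mem_centralizer_iff.1 (hTC hz) s hs
      rw [this]; simpa using hz
    · have := Subgroup.mem_centralizer_iff.1 (hTC hz) s hs
      have : z = s * z * s⁻¹ := by
        have h3 := congrArg (fun t => s⁻¹ * t) this
        simp [mul_assoc] at h3
        simpa [mul_assoc] using h3.symm
      rw [this]; exact hz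
  · rw [hT.index_eq_card, hn]
  · rw [hTc]; exact S.not_dvd_index

theorem mem_compl {G : Type*} [Group G] [Finite G] {p n : ℕ} (hp : p.Prime) {H : Subgroup G}
    (hH : H.Normal) (hi : H.index = p ^ n) {x : G} (hx : ¬ p ∣ orderOf x) : x ∈ H := by
  have h1 : x ^ (p ^ n) ∈ H := hi ▸ Subgroup.pow_index_mem H x
  have hco : Nat.Coprime (p ^ n) (orderOf x) := ((hp.coprime_iff_not_dvd).2 hx).pow_left n
  obtain ⟨m, hm⟩ := exists_pow_eq_self_of_coprime hco
  rw [← hm]; exact H.pow_mem h1 m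

theorem pnil_lift {G : Type*} [Group G] [Finite G] {p n : ℕ} (hp : p.Prime) (M : Subgroup G)
    (hM : M.Normal) (hi : M.index = p ^ n) (h : IsPNilpotent p M) : IsPNilpotent p G := by
  obtain ⟨K, hK, ⟨m, hm⟩, hc⟩ := h
  refine ⟨K.map M.subtype, ⟨?_⟩, ⟨m + n, ?_⟩, ?_⟩
  · rintro _ ⟨k, hk, rfl⟩ g
    refine ⟨⟨g * k * g⁻¹, hM.conj_mem _ k.2 g⟩, ?_, rfl⟩
    refine mem_compl hp hK hm ?_
    have h1 : orderOf k ∣ Nat.card K := by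
      rw [← Subgroup.orderOf_mk k hk]; exact orderOf_dvd_natCard _
    have h2 : orderOf (⟨g * k * g⁻¹, hM.conj_mem _ k.2 g⟩ : M) = orderOf k := by
      rw [Subgroup.orderOf_mk, ← Subgroup.orderOf_coe k]
      exact orderOf_injective (MulAut.conj g).toMonoidHom (MulAut.conj g).injective (k : G)
    rw [h2]
    exact fun h => hc (h.trans h1)
  · rw [Subgroup.index_map_subtype, hm, hi, pow_add]
  · rwa [Nat.card_congr (K.equivMapOfInjective M.subtype M.subtype_injective).toEquiv.symm]

theorem nrm_pnil_aux.{u} {p : ℕ} (hp : p.Prime) (n : ℕ) : ∀ (G : Type u) [Group G] [Finite G],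
    Nat.card G = n → Nrm p G → IsPNilpotent p G := by
  induction n using Nat.strong_induction_on with
  | _ n ih =>
  intro G _ _ hcard h
  have := Fact.mk hp
  set N := Subgroup.normalClosure {x : G | ∃ k : ℕ, x ^ p ^ k = 1} with hN
  have hNn : N.Normal := Subgroup.normalClosure_normal
  by_cases hex : ∃ q : ℕ, q.Prime ∧ q ≠ p ∧ ∃ Q : Sylow q G, (Q : Subgroup G) ⊓ N ≠ ⊥
  · obtain ⟨q, hq, hqp, Q, hQ⟩ := hex
    have := Fact.mk hq
    set K := (Q : Subgroup G) ⊓ N with hKdef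
    have hK : K.Normal := by
      constructor
      rintro y ⟨hy1, hy2⟩ g
      have hN' : g * y * g⁻¹ ∈ N := hNn.conj_mem _ hy2 g
      refine ⟨?_, hN'⟩
      have h1 : g * y * g⁻¹ ∈ ((g • Q : Sylow q G) : Subgroup G) :=
        ⟨y, hy1, rfl⟩
      have h2 := IsPGroup.inf_normalizer_sylow (g • Q : Sylow q G).isPGroup' Q
      have h3 : g * y * g⁻¹ ∈ ((g • Q : Sylow q G) : Subgroup G) ⊓ (Q : Subgroup G) := by
        rw [← h2]; exact ⟨h1, h.le_normalizer hq hqp Q hN'⟩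
      exact h3.2
    have hKp : ¬ p ∣ Nat.card K := by
      have : IsPGroup q K := Q.isPGroup'.to_le inf_le_left
      obtain ⟨m, hm⟩ := IsPGroup.iff_card.1 this
      rw [hm]
      intro hd
      exact hqp ((Nat.prime_dvd_prime_iff_eq hp hq).1 (hp.dvd_of_dvd_pow hd)).symm
    have hlt : Nat.card (G ⧸ K) < n := by
      have h1 := Subgroup.card_eq_card_quotient_mul_card_subgroup K
      have h2 : 1 < Nat.card K := by
        rw [Subgroup.one_lt_card_iff_ne_bot]; exact hQ
      have h3 : 0 < Nat.card (G ⧸ K) := Nat.card_pos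
      rw [← hcard, h1]; nlinarith
    have hsurj := QuotientGroup.mk'_surjective K
    obtain ⟨H, hH, ⟨m, hm⟩, hHc⟩ := ih _ hlt (G ⧸ K) rfl (by
      intro x k hx r hr hrp R y hy
      have := Fact.mk hr
      obtain ⟨P, hP⟩ := pelt_mem_sylow hx
      obtain ⟨P', rfl⟩ := Sylow.mapSurjective_surjective hsurj p P
      obtain ⟨R', rfl⟩ := Sylow.mapSurjective_surjective hsurj r R
      obtain ⟨x', hx', rfl⟩ := hP
      obtain ⟨y', hy', rfl⟩ := hy
      obtain ⟨k', hk'⟩ := sylow_pelt P' hx'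
      exact ⟨x' * y' * x'⁻¹, h x' k' hk' r hr hrp R' y' hy', by simp⟩)
    refine ⟨H.comap (QuotientGroup.mk' K), inferInstance, ⟨m, ?_⟩, ?_⟩
    · rw [Subgroup.index_comap_of_surjective _ hsurj, hm]
    · have h1 : Nat.card (H.comap (QuotientGroup.mk' K)) = Nat.card H * Nat.card K := by
        have e1 := Subgroup.card_mul_index (H.comap (QuotientGroup.mk' K))
        rw [Subgroup.index_comap_of_surjective _ hsurj] at e1
        have e2 := Subgroup.card_mul_index H
        have e3 := Subgroup.card_eq_card_quotient_mul_card_subgroup K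
        have : 0 < H.index := Nat.pos_of_ne_zero Subgroup.FiniteIndex.index_ne_zero
        rw [← e2] at e3
        rw [e3] at e1
        apply Nat.eq_of_mul_eq_mul_right this
        rw [e1]; ring
      rw [h1, hp.dvd_mul]
      tauto
  · push Not at hex
    obtain ⟨S⟩ : Nonempty (Sylow p G) := inferInstance
    have hSN : (S : Subgroup G) ≤ N := fun x hx => Subgroup.subset_normalClosure (sylow_pelt S hx)
    have hNp : IsPGroup p N := by
      obtain hc := Nat.eq_prime_pow_of_unique_prime_dvd (n := Nat.card N) (p := p)
        Nat.card_pos.ne' (by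
          intro q hq hqd
          by_contra hqp
          have := Fact.mk hq
          obtain ⟨x, hx⟩ := exists_prime_orderOf_dvd_card' q hqd
          have hx1 : (x : G) ^ q ^ 1 = 1 := by
            rw [pow_one, ← hx, ← Subgroup.orderOf_coe x, pow_orderOf_eq_one]
          obtain ⟨Q, hQ⟩ := pelt_mem_sylow hx1
          have : (x : G) ∈ (Q : Subgroup G) ⊓ N := ⟨hQ, x.2⟩
          rw [hex q hq hqp Q, Subgroup.mem_bot] at this
          have hx2 : x = 1 := Subtype.ext this
          rw [hx2, orderOf_one] at hx
          exact hq.one_lt.ne hx)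
      exact IsPGroup.of_card hc
    have hSeq : N = (S : Subgroup G) := S.is_maximal' hNp hSN
    refine pnil_of_normal hp S (hSeq ▸ hNn) ?_
    intro q hq hqp Q y hy
    rw [Subgroup.mem_centralizer_iff]
    intro s hs
    have hs' : s ∈ N := by rw [hSeq]; exact hs
    have h1 : s * y * s⁻¹ * y⁻¹ ∈ (Q : Subgroup G) ⊓ N := by
      refine ⟨(Q : Subgroup G).mul_mem ((Subgroup.mem_normalizer_iff.1 (h.le_normalizer hq hqp Q hs') y).1 hy)
        ((Q : Subgroup G).inv_mem hy), ?_⟩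
      have := N.mul_mem hs' (hNn.conj_mem _ (N.inv_mem hs') y)
      simpa [mul_assoc] using this
    rw [hex q hq hqp Q, Subgroup.mem_bot] at h1
    rw [mul_inv_eq_one, mul_inv_eq_iff_eq_mul] at h1
    exact h1

/-- An S-permutable subgroup of smallest prime order normalizes all Sylow `q`-subgroups. -/
theorem sperm_norm {G : Type*} [Group G] [Finite G] {p : ℕ} (hp : p.Prime)
    (hmin : ∀ q : ℕ, q.Prime → q ∣ Nat.card G → p ≤ q) {x : G} (hx : orderOf x = p)
    (hs : IsSPermutable (Subgroup.zpowers x)) (q : ℕ) (hq : q.Prime) (hqp : q ≠ p)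
    (Q : Sylow q G) : ∀ y ∈ Q, x * y * x⁻¹ ∈ Q := by
  have := Fact.mk hp
  have := Fact.mk hq
  set A := Subgroup.zpowers x with hA
  have hperm := hs q hq Q
  have hAc : Nat.card A = p := by rw [hA, Nat.card_zpowers, hx]
  set M := A ⊔ (Q : Subgroup G) with hM
  have hMeq : (M : Set G) = (A : Set G) * ((Q : Subgroup G) : Set G) := by
    let L : Subgroup G :=
      { carrier := (A : Set G) * ((Q : Subgroup G) : Set G)
        one_mem' := ⟨1, A.one_mem, 1, Q.one_mem, one_mul 1⟩
        mul_mem' := by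
          rintro _ _ ⟨a, ha, b, hb, rfl⟩ ⟨c, hc, d, hd, rfl⟩
          have h1 : b * c ∈ (A : Set G) * ((Q : Subgroup G) : Set G) :=
            hperm ▸ Set.mul_mem_mul hb hc
          obtain ⟨e, he, f, hf, hef⟩ := h1
          refine ⟨a * e, A.mul_mem ha he, f * d, mul_mem hf hd, ?_⟩
          have hef' : e * f = b * c := hef
          change a * e * (f * d) = a * b * (c * d)
          calc a * e * (f * d) = a * (e * f) * d := by group
            _ = a * b * (c * d) := by rw [hef']; group
        inv_mem' := by
          rintro _ ⟨a, ha, b, hb, rfl⟩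
          rw [hperm]
          exact ⟨b⁻¹, inv_mem hb, a⁻¹, A.inv_mem ha, (mul_inv_rev a b).symm⟩ }
    apply Set.Subset.antisymm
    · have : M ≤ L := sup_le
        (fun a ha => ⟨a, ha, 1, Q.one_mem, mul_one a⟩) (fun b hb => ⟨1, A.one_mem, b, hb, one_mul b⟩)
      exact this
    · rintro _ ⟨a, ha, b, hb, rfl⟩
      exact M.mul_mem ((le_sup_left : A ≤ M) ha) ((le_sup_right : (Q : Subgroup G) ≤ M) hb)
  have hQM : (Q : Subgroup G) ≤ M := le_sup_right
  have hAM : A ≤ M := le_sup_left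
  have hdisj : Disjoint A (Q : Subgroup G) :=
    IsPGroup.disjoint_of_ne p q hqp.symm _ _ (IsPGroup.of_card (n := 1) (by simpa using hAc))
      Q.isPGroup'
  have hcomp : Subgroup.IsComplement' (A.subgroupOf M) ((Q : Subgroup G).subgroupOf M) := by
    apply Subgroup.isComplement'_of_disjoint_and_mul_eq_univ
    · rw [Subgroup.disjoint_def]
      intro z hz1 hz2
      exact Subtype.ext (Subgroup.disjoint_def.1 hdisj hz1 hz2)
    · ext z
      simp only [Set.mem_univ, iff_true]
      have : (z : G) ∈ (A : Set G) * ((Q : Subgroup G) : Set G) := hMeq ▸ z.2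
      obtain ⟨a, ha, b, hb, hab⟩ := this
      exact ⟨⟨a, hAM ha⟩, ha, ⟨b, hQM hb⟩, hb, Subtype.ext hab⟩
  have hidx : ((Q : Subgroup G).subgroupOf M).index = p := by
    rw [hcomp.index_eq_card, Nat.card_congr (Subgroup.subgroupOfEquivOfLe hAM).toEquiv, hAc]
  have hmf : (Nat.card M).minFac = p := by
    have hpd : p ∣ Nat.card M := hidx ▸ Subgroup.index_dvd_card _
    have hne : Nat.card M ≠ 1 := by
      intro h1; rw [h1] at hpd; exact hp.one_lt.ne' (Nat.dvd_one.1 hpd)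
    exact le_antisymm (Nat.minFac_le_of_dvd hp.two_le hpd)
      (hmin _ (Nat.minFac_prime hne) ((Nat.minFac_dvd _).trans (Subgroup.card_subgroup_dvd_card M)))
  have hnorm := Subgroup.normal_of_index_eq_minFac_card (hidx.trans hmf.symm)
  intro y hy
  exact hnorm.conj_mem ⟨y, hQM hy⟩ hy ⟨x, hAM (Subgroup.mem_zpowers x)⟩

theorem supp_cases {G : Type*} [Group G] [Finite G] {p : ℕ} (hp : p.Prime)
    (hmin : ∀ q : ℕ, q.Prime → q ∣ Nat.card G → p ≤ q) {x : G} (hx : orderOf x = p)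
    (hw : WeaklySPhiSupplemented (Subgroup.zpowers x)) :
    IsSPermutable (Subgroup.zpowers x) ∨ ∃ T : Subgroup G, T.Normal ∧ T.index = p ∧ x ∉ T := by
  have := Fact.mk hp
  obtain ⟨T, hT, hle⟩ := hw
  set A := Subgroup.zpowers x with hA
  have hAc : Nat.card A = p := by rw [hA, Nat.card_zpowers, hx]
  have hsimp : IsSimpleGroup A := isSimpleGroup_of_prime_card hAc
  have hsub : ∀ B : Subgroup G, B ≤ A → B = ⊥ ∨ B = A := by
    intro B hB
    have hd := Subgroup.card_dvd_of_le hB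
    rw [hAc, Nat.dvd_prime hp] at hd
    rcases hd with hd | hd
    · left; exact Subgroup.card_eq_one.1 hd
    · right; exact Subgroup.eq_of_le_of_card_ge hB (by rw [hd, hAc])
  have hfr : frattini A = ⊥ := by
    rw [eq_bot_iff]
    apply frattini_le_coatom
    refine ⟨bot_ne_top, fun B hB => ?_⟩
    have hd := Subgroup.card_subgroup_dvd_card B
    rw [hAc, Nat.dvd_prime hp] at hd
    rcases hd with hd | hd
    · exact absurd (Subgroup.card_eq_one.1 hd) hB.ne'
    · exact Subgroup.eq_top_of_card_eq B (hd.trans hAc.symm)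
  rw [hfr, Subgroup.map_bot, bot_sup_eq] at hle
  by_cases hs : IsSPermutable A
  · exact Or.inl hs
  · right
    have hcore : sCore A = ⊥ := by
      rw [eq_bot_iff]
      refine iSup₂_le ?_
      rintro B ⟨hB, hBs⟩
      rcases hsub B hB with rfl | rfl
      · exact le_rfl
      · exact absurd hBs hs
    rw [hcore, le_bot_iff] at hle
    have hcomp := Subgroup.isComplement'_of_disjoint_and_mul_eq_univ (disjoint_iff.2 hle) hT
    have hidx : T.index = p := by rw [hcomp.index_eq_card, hAc]
    have hmf : (Nat.card G).minFac = p := by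
      have hpd : p ∣ Nat.card G := hidx ▸ Subgroup.index_dvd_card _
      have hne : Nat.card G ≠ 1 := by
        intro h1; rw [h1] at hpd; exact hp.one_lt.ne' (Nat.dvd_one.1 hpd)
      exact le_antisymm (Nat.minFac_le_of_dvd hp.two_le hpd)
        (hmin _ (Nat.minFac_prime hne) (Nat.minFac_dvd _))
    refine ⟨T, Subgroup.normal_of_index_eq_minFac_card (hidx.trans hmf.symm), hidx, ?_⟩
    intro hxT
    have : x ∈ A ⊓ T := ⟨Subgroup.mem_zpowers x, hxT⟩
    rw [hle, Subgroup.mem_bot] at this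
    rw [this, orderOf_one] at hx
    exact hp.one_lt.ne hx

theorem stmt9 {G : Type*} [Group G] [Finite G] (p : ℕ) (hp : p.Prime)
    (hdvd : p ∣ Nat.card G) (hmin : ∀ q : ℕ, q.Prime → q ∣ Nat.card G → p ≤ q)
    (S : Sylow p G)
    (hexp : ∀ x : G, x ∈ S → x ≠ 1 → orderOf x = p)
    (hsupp : ∀ x : G, x ∈ S → orderOf x = p →
      WeaklySPhiSupplemented (Subgroup.zpowers x)) :
    IsPNilpotent p G := by
  have := Fact.mk hp
  set M : Subgroup G := ⨅ T ∈ {T : Subgroup G | T.Normal ∧ T.index = p}, T with hM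
  have hMmem : ∀ y : G, y ∈ M ↔ ∀ T : Subgroup G, T.Normal → T.index = p → y ∈ T := by
    intro y
    simp [hM, Subgroup.mem_iInf]
  have hMn : M.Normal := by
    constructor
    intro y hy g
    rw [hMmem] at hy ⊢
    exact fun T hT hi => hT.conj_mem _ (hy T hT hi) g
  -- the index of `M` is a power of `p`
  have hidx : M.index = p ^ M.index.primeFactorsList.length := by
    refine Nat.eq_prime_pow_of_unique_prime_dvd Subgroup.FiniteIndex.index_ne_zero ?_
    intro q hq hqd
    by_contra hqp
    have := Fact.mk hq
    obtain ⟨Q⟩ : Nonempty (Sylow q G) := inferInstance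
    refine Q.not_dvd_index (hqd.trans (Subgroup.index_dvd_of_le ?_))
    intro y hy
    rw [hMmem]
    intro T hT hi
    refine mem_compl (n := 1) hp hT (by simpa using hi) ?_
    obtain ⟨k, hk⟩ := sylow_pelt Q hy
    intro hd
    have := hp.dvd_of_dvd_pow (hd.trans (orderOf_dvd_of_pow_eq_one hk))
    exact hqp ((Nat.prime_dvd_prime_iff_eq hp hq).1 this).symm
  refine pnil_lift hp M hMn hidx (nrm_pnil_aux hp _ M rfl ?_)
  intro x k hxk q hq hqp R y hy
  obtain ⟨Q, hQ⟩ := Sylow.exists_comap_subtype_eq R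
  have hRQ : ∀ z : M, z ∈ R ↔ (z : G) ∈ Q := by
    intro z
    change z ∈ (R : Subgroup M) ↔ _
    rw [← hQ]; rfl
  rw [hRQ] at hy ⊢
  have hxk' : (x : G) ^ p ^ k = 1 := by simpa using congrArg Subtype.val hxk
  obtain ⟨P, hP⟩ := pelt_mem_sylow hxk'
  obtain ⟨g, hg⟩ := MulAction.exists_smul_eq G S P
  have hP' : (x : G) ∈ ((g • S : Sylow p G) : Subgroup G) := by rw [hg]; exact hP
  obtain ⟨s, hs, hsx⟩ := hP'
  have hsx' : g * s * g⁻¹ = x := hsx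
  by_cases hs1 : s = 1
  · have : (x : G) = 1 := by rw [← hsx', hs1]; simp
    simpa [this] using hy
  have hso := hexp s hs hs1
  rcases supp_cases hp hmin hso (hsupp s hs hso) with hperm | ⟨T, hTn, hTi, hsT⟩
  · have hy' : g⁻¹ * y * g ∈ (g⁻¹ • Q : Sylow q G) := ⟨y, hy, by simp⟩
    have h1 := sperm_norm hp hmin hso hperm q hq hqp (g⁻¹ • Q : Sylow q G) _ hy'
    obtain ⟨w, hw, hw2⟩ := h1
    have hw3 : g⁻¹ * w * g = s * (g⁻¹ * y * g) * s⁻¹ := by simpa using hw2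
    have : ((x * y * x⁻¹ : M) : G) = w := by
      have hw4 : w = g * (g⁻¹ * w * g) * g⁻¹ := by group
      rw [hw4, hw3]
      simp only [Subgroup.coe_mul, Subgroup.coe_inv, ← hsx']
      group
    rw [this]; exact hw
  · exfalso
    apply hsT
    have h1 := (hMmem x).1 x.2 T hTn hTi
    have h2 := hTn.conj_mem _ h1 g⁻¹
    rw [← hsx'] at h2
    simpa [mul_assoc] using h2
end

section
/- Let G be a finite group, N ⊴ G with G/N p-nilpotent for the smallest prime p dividing |G|. If every subgroup of N of order p lies in Z(G) and p is odd, then G is p-nilpotent. -/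
open scoped Pointwise

theorem aux_pow_comm {G : Type*} [Group G] {u v z : G} (h : u * v = v * u * z)
    (hu : Commute z u) (n : ℕ) : u ^ n * v = v * u ^ n * z ^ n := by
  induction n with
  | zero => simp
  | succ n ih =>
    have h1 : Commute (z ^ n) u := hu.pow_left n
    calc u ^ (n+1) * v = u * (u ^ n * v) := by rw [pow_succ']; group
      _ = u * v * u ^ n * z ^ n := by rw [ih]; group
      _ = v * u * (z * u ^ n) * z ^ n := by rw [h]; group
      _ = v * u * (u ^ n * z) * z ^ n := by rw [(hu.pow_right n).eq]
      _ = _ := by rw [pow_succ' u, pow_succ' z]; group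

theorem aux_mul_pow {G : Type*} [Group G] {u v z : G} (h : u * v = v * u * z)
    (hu : Commute z u) (hv : Commute z v) (n : ℕ) :
    (v * u) ^ n = v ^ n * u ^ n * z ^ (n.choose 2) := by
  induction n with
  | zero => simp
  | succ n ih =>
    have h1 : Commute (z ^ (n.choose 2)) (v * u) := (hv.mul_right hu).pow_left _
    have h2 : Commute (z ^ n) u := hu.pow_left n
    calc (v * u) ^ (n+1) = v ^ n * u ^ n * (z ^ (n.choose 2) * (v * u)) := by
          rw [pow_succ, ih]; group
      _ = v ^ n * (u ^ n * v) * u * z ^ (n.choose 2) := by rw [h1.eq]; group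
      _ = v ^ n * v * u ^ n * (z ^ n * u) * z ^ (n.choose 2) := by
          rw [aux_pow_comm h hu]; group
      _ = v ^ (n+1) * u ^ (n+1) * (z ^ n * z ^ (n.choose 2)) := by
          rw [h2.eq, pow_succ v, pow_succ u]; group
      _ = _ := by rw [← pow_add, Nat.choose_succ_succ' n 1, Nat.choose_one_right]

/-- If `a` moves `y` by an element `c` commuting with `a`, of order prime to that of `a`, then
`a` commutes with `y`. -/
theorem aux_fix {G : Type*} [Group G] {a y c : G} (h : a * y * a⁻¹ = y * c)
    (hc : Commute a c) (hco : (orderOf a).Coprime (orderOf c)) : Commute a y := by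
  have key : ∀ n : ℕ, a ^ n * y * (a ^ n)⁻¹ = y * c ^ n := by
    intro n
    induction n with
    | zero => simp
    | succ n ih =>
      calc a ^ (n+1) * y * (a ^ (n+1))⁻¹ = a * (a ^ n * y * (a ^ n)⁻¹) * a⁻¹ := by
            rw [pow_succ']; group
        _ = (a * y * a⁻¹) * (a * c ^ n * a⁻¹) := by rw [ih]; group
        _ = y * c * c ^ n := by
            rw [h, (hc.pow_right n).eq]; group
        _ = _ := by rw [pow_succ']; group
  have h1 := key (orderOf a)
  rw [pow_orderOf_eq_one] at h1
  have h2 : c ^ orderOf a = 1 := by simpa using h1.symm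
  have h3 : orderOf c = 1 :=
    Nat.Coprime.eq_one_of_dvd hco.symm (orderOf_dvd_of_pow_eq_one h2)
  rw [orderOf_eq_one_iff] at h3
  rw [h3, mul_one] at h
  exact mul_inv_eq_iff_eq_mul.mp h

theorem aux_normalizer {G : Type*} [Group G] [Finite G] {p : ℕ} [Fact p.Prime]
    {C D : Subgroup G} (hD : IsPGroup p D) (hCD : C < D) :
    C < D ⊓ Subgroup.normalizer C := by
  have := hD.isNilpotent
  have h1 : C.subgroupOf D < ⊤ := by
    rw [lt_top_iff_ne_top, Ne, Subgroup.subgroupOf_eq_top]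
    exact not_le_of_gt hCD
  have h2 := Group.normalizerCondition_of_isNilpotent (G := D) _ h1
  obtain ⟨x, hx, hxC⟩ := SetLike.exists_of_lt h2
  refine lt_of_le_of_ne (le_inf hCD.le Subgroup.le_normalizer) ?_
  intro heq
  apply hxC
  rw [Subgroup.mem_subgroupOf]
  rw [heq]
  refine Subgroup.mem_inf.2 ⟨x.2, ?_⟩
  rw [Subgroup.mem_normalizer_iff]
  rw [Subgroup.mem_normalizer_iff] at hx
  intro h
  constructor
  · intro hh
    exact (hx ⟨h, hCD.le hh⟩).1 hh
  · intro hh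
    have hD' : h ∈ D := by
      have := D.mul_mem (D.mul_mem (D.inv_mem x.2) (hCD.le hh)) x.2
      simpa [mul_assoc] using this
    exact (hx ⟨h, hD'⟩).2 hh

theorem aux_coprime_s15 {G : Type*} [Group G] [Finite G] {p : ℕ} [hp : Fact p.Prime] (hodd : Odd p)
    (a : G) (ha : (orderOf a).Coprime p) (n : ℕ) : ∀ D : Subgroup G, Nat.card D = n →
    IsPGroup p D →
    (∀ x ∈ D, a * x * a⁻¹ ∈ D) → (∀ x ∈ D, orderOf x = p → Commute a x) →
    ∀ x ∈ D, Commute a x := by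
  induction n using Nat.strong_induction_on with
  | _ n ih =>
  intro D hn hD hinv hord
  by_contra hcon
  push Not at hcon
  obtain ⟨x0, hx0, hx0'⟩ := hcon
  have hmin : ∀ E : Subgroup G, E < D → (∀ x ∈ E, a * x * a⁻¹ ∈ E) → ∀ x ∈ E, Commute a x := by
    intro E hE hEi
    refine ih (Nat.card E) ?_ E rfl (hD.to_le hE.le) hEi (fun x hx => hord x (hE.le hx))
    rw [← hn]
    exact Set.ncard_lt_ncard hE (Set.toFinite _)
  have hcop : ∀ c ∈ D, (orderOf a).Coprime (orderOf c) := by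
    intro c hc
    have := hD.orderOf_coprime (n := orderOf a) ha.symm ⟨c, hc⟩
    rw [Subgroup.orderOf_mk] at this
    exact this.symm
  have hcm : ∀ y ∈ D, y⁻¹ * (a * y * a⁻¹) ∈ D := fun y hy =>
    D.mul_mem (D.inv_mem hy) (hinv y hy)
  have hfix : ∀ y ∈ D, Commute a (y⁻¹ * (a * y * a⁻¹)) → Commute a y := by
    intro y hy hc
    refine aux_fix (c := y⁻¹ * (a * y * a⁻¹)) (by group) hc (hcop _ (hcm y hy))
  let C : Subgroup G := D ⊓ Subgroup.centralizer {a}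
  have memC : ∀ x, x ∈ C ↔ x ∈ D ∧ Commute a x := by
    intro x
    simp only [C, Subgroup.mem_inf, Subgroup.mem_centralizer_singleton_iff]
    exact and_congr_right fun _ => ⟨fun h => h.symm, fun h => h.symm⟩
  have hCD : C < D := by
    refine lt_of_le_of_ne inf_le_left fun h => hx0' ?_
    exact ((memC x0).1 (h ▸ hx0)).2
  have hconjC : ∀ c ∈ C, a * c * a⁻¹ = c := by
    intro c hc
    rw [((memC c).1 hc).2.eq]; group
  have hmem : ∀ E : Subgroup G, E ≤ D → (∀ x ∈ E, a * x * a⁻¹ ∈ E) → E = D ∨ E ≤ C := by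
    intro E hE hEi
    rcases hE.eq_or_lt with h | h
    · exact Or.inl h
    · exact Or.inr fun x hx => (memC x).2 ⟨hE hx, hmin E h hEi x hx⟩
  have haC : a ∈ Subgroup.normalizer (C : Set G) := by
    rw [Subgroup.mem_normalizer_iff]
    intro h
    constructor
    · intro hh; rw [hconjC h hh]; exact hh
    · intro hh
      have h2 := hconjC _ hh
      have : a * h * a⁻¹ = h := by
        have h3 : a * h * a⁻¹ = a⁻¹ * (a * (a * h * a⁻¹) * a⁻¹) * a := by group
        rw [h3, h2]; group
      rwa [this] at hh
  -- `C` is normal in `D`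
  have hCn : ∀ x ∈ D, ∀ c ∈ C, x * c * x⁻¹ ∈ C := by
    have h1 := aux_normalizer hD hCD
    have hor := hmem (D ⊓ Subgroup.normalizer C) inf_le_left ?side
    case side =>
      intro x hx
      exact ⟨hinv x hx.1, Subgroup.mul_mem _ (Subgroup.mul_mem _ haC hx.2) (Subgroup.inv_mem _ haC)⟩
    rcases hor with h | h
    · intro x hx c hc
      rw [← h] at hx
      exact ((Subgroup.mem_normalizer_iff).1 hx.2 c).1 hc
    · exact absurd h (not_le_of_gt h1)
  -- `C` is central in `D`
  have hCz : ∀ c ∈ C, ∀ x ∈ D, Commute c x := by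
    have hcomm : ∀ x ∈ D, ∀ c ∈ C, Commute c (x⁻¹ * (a * x * a⁻¹)) := by
      intro x hx c hc
      have h1 := hconjC _ (hCn x hx c hc)
      have h2 : (a * x * a⁻¹) * c * (a * x * a⁻¹)⁻¹ = x * c * x⁻¹ := by
        have h3 : a⁻¹ * c * a = c := by
          rw [mul_assoc, ← ((memC c).1 hc).2.eq]; group
        calc (a * x * a⁻¹) * c * (a * x * a⁻¹)⁻¹ = a * (x * (a⁻¹ * c * a) * x⁻¹) * a⁻¹ := by group
          _ = _ := by rw [h3, h1]
      have h4 : (x⁻¹ * (a * x * a⁻¹)) * c * (x⁻¹ * (a * x * a⁻¹))⁻¹ = c := by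
        calc (x⁻¹ * (a * x * a⁻¹)) * c * (x⁻¹ * (a * x * a⁻¹))⁻¹
            = x⁻¹ * ((a * x * a⁻¹) * c * (a * x * a⁻¹)⁻¹) * x := by group
          _ = c := by rw [h2]; group
      exact (mul_inv_eq_iff_eq_mul.mp h4).symm
    have hor := hmem (D ⊓ Subgroup.centralizer (C : Set G)) inf_le_left ?side
    case side =>
      intro x hx
      refine ⟨hinv x hx.1, Subgroup.mem_centralizer_iff.2 fun c hc => ?_⟩
      have h1 : Commute c x := Subgroup.mem_centralizer_iff.1 hx.2 c hc
      have h2 : Commute c a := ((memC c).1 hc).2.symm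
      exact (h2.mul_right h1).mul_right h2.inv_right
    rcases hor with h | h
    · intro c hc x hx
      rw [← h] at hx
      exact (Subgroup.mem_centralizer_iff.1 hx.2) c hc
    · exfalso
      apply hx0'
      refine hfix x0 hx0 ?_
      refine ((memC _).1 (h ⟨hcm x0 hx0, ?_⟩)).2
      exact Subgroup.mem_centralizer_iff.2 fun c hc => hcomm x0 hx0 c hc
  -- the derived subgroup of `D` lies in `C`
  have hder : ∀ x ∈ D, ∀ y ∈ D, x⁻¹ * y⁻¹ * x * y ∈ C := by
    have hnil := hD.isNilpotent
    have hnt : Nontrivial D := by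
      refine ⟨⟨⟨x0, hx0⟩, 1, ?_⟩⟩
      intro h
      have : x0 = 1 := congrArg Subtype.val h
      exact hx0' (this ▸ Commute.one_right a)
    have hlt := Group.IsSolvable.commutator_lt_top_of_nontrivial D
    have hlt' : ⁅D, D⁆ < D := by
      refine lt_of_le_of_ne (Subgroup.commutator_le_self D) ?_
      intro h
      apply hlt.ne
      apply Subgroup.map_subtype_inj.1
      rw [Subgroup.map_subtype_commutator, h, ← MonoidHom.range_eq_map, Subgroup.range_subtype]
    have hor := hmem ⁅D, D⁆ hlt'.le ?side
    case side =>
      intro x hx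
      have : (⁅D, D⁆).map (MulAut.conj a).toMonoidHom ≤ ⁅D, D⁆ := by
        rw [Subgroup.map_commutator]
        have hle : D.map (MulAut.conj a).toMonoidHom ≤ D := by
          rintro _ ⟨z, hz, rfl⟩
          exact hinv z hz
        exact Subgroup.commutator_mono hle hle
      exact this ⟨x, hx, rfl⟩
    rcases hor with h | h
    · exact absurd h hlt'.ne
    · intro x hx y hy
      have := h (Subgroup.commutator_mem_commutator (D.inv_mem hx) (D.inv_mem hy))
      simpa [commutatorElement_def] using this
  -- choose `y ∉ C` with `y ^ p ∈ C`
  obtain ⟨y, hyD, hyC, hyp⟩ : ∃ y ∈ D, y ∉ C ∧ y ^ p ∈ C := by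
    have hex : ∃ k, x0 ^ p ^ k ∈ C := by
      obtain ⟨k, hk⟩ := isPGroup_iff_pow_pow_eq_one.1 hD ⟨x0, hx0⟩
      have : x0 ^ p ^ k = 1 := congrArg Subtype.val hk
      exact ⟨k, this ▸ C.one_mem⟩
    classical
    have h1 := Nat.find_spec hex
    have h2 : Nat.find hex ≠ 0 := by
      intro h
      rw [h] at h1
      apply hx0'
      exact ((memC _).1 (by simpa using h1)).2
    obtain ⟨m, hm⟩ := Nat.exists_eq_succ_of_ne_zero h2
    refine ⟨x0 ^ p ^ m, D.pow_mem hx0 _, Nat.find_min hex (by omega), ?_⟩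
    rw [← pow_mul, ← pow_succ]
    rwa [hm] at h1
  apply hyC
  refine (memC y).2 ⟨hyD, hfix y hyD ?_⟩
  set w := a * y * a⁻¹ with hw
  have hwD : w ∈ D := hinv y hyD
  have hwp : w ^ p = y ^ p := by
    rw [hw, conj_pow]; exact hconjC _ hyp
  -- `u = w`, `v = y⁻¹`
  let z := w⁻¹ * y * w * y⁻¹
  have hzC : z ∈ C := by
    have := hder w hwD y⁻¹ (D.inv_mem hyD)
    simpa [z] using this
  have hz : w * y⁻¹ = y⁻¹ * w * z := by simp only [z]; group
  have hzw := hCz z hzC w hwD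
  have hzy := hCz z hzC y⁻¹ (D.inv_mem hyD)
  have hzp : z ^ p = 1 := by
    have h1 := aux_pow_comm hz hzw p
    have h2 : Commute (w ^ p) y⁻¹ := by
      rw [hwp]; exact hCz _ hyp _ (D.inv_mem hyD)
    rw [h2.eq] at h1
    simpa using h1.symm
  have hzc : z ^ (p.choose 2) = 1 := by
    have h2 : 2 < p := by
      have := hp.out.two_le
      rcases this.eq_or_lt with h | h
      · subst h; exact absurd hodd (by decide)
      · exact h
    obtain ⟨m, hm⟩ := hp.out.dvd_choose_self (k := 2) (by norm_num) h2
    rw [hm, pow_mul, hzp, one_pow]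
  have hfin : (y⁻¹ * w) ^ p = 1 := by
    rw [aux_mul_pow hz hzw hzy p, hzc, hwp]; simp
  rcases (Nat.dvd_prime hp.out).1 (orderOf_dvd_of_pow_eq_one hfin) with h | h
  · rw [orderOf_eq_one_iff] at h
    rw [h]; exact Commute.one_right a
  · exact hord _ (D.mul_mem (D.inv_mem hyD) hwD) h

theorem aux_factor {G : Type*} [Group G] [Finite G] {p : ℕ} [hp : Fact p.Prime]
    (C : Subgroup G) [C.Normal] (hC : ∀ a : G, (orderOf a).Coprime p → a ∈ C) (S : Sylow p G)
    (g : G) : ∃ c ∈ C, ∃ s ∈ S, g = c * s := by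
  have hq : IsPGroup p (G ⧸ C) := by
    rw [isPGroup_iff_pow_pow_eq_one]
    intro q
    obtain ⟨x, rfl⟩ := QuotientGroup.mk_surjective q
    obtain ⟨k, m, hm, hk⟩ := Nat.exists_eq_pow_mul_and_not_dvd (n := orderOf x)
      (orderOf_pos x).ne' p hp.out.ne_one
    refine ⟨k, ?_⟩
    rw [← QuotientGroup.mk_pow, QuotientGroup.eq_one_iff]
    apply hC
    rw [orderOf_pow_of_dvd (pow_ne_zero _ hp.out.ne_zero) (hk ▸ dvd_mul_right _ _), hk,
      Nat.mul_div_cancel_left _ (pow_pos hp.out.pos k)]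
    exact ((Nat.Prime.coprime_iff_not_dvd hp.out).2 hm).symm
  obtain ⟨k, hk⟩ := IsPGroup.iff_card.1 hq
  have htop : C ⊔ (S : Subgroup G) = ⊤ := by
    rw [← Subgroup.index_eq_one]
    have h1 : (C ⊔ (S : Subgroup G)).index ∣ p ^ k := by
      rw [← hk]; exact Subgroup.index_dvd_of_le le_sup_left
    have h2 : (C ⊔ (S : Subgroup G)).index ∣ (S : Subgroup G).index :=
      Subgroup.index_dvd_of_le le_sup_right
    have h3 : (p ^ k).Coprime (S : Subgroup G).index :=
      Nat.Coprime.pow_left k ((Nat.Prime.coprime_iff_not_dvd hp.out).2 S.not_dvd_index)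
    exact Nat.eq_one_of_dvd_coprimes h3 h1 h2
  have hg : g ∈ C ⊔ (S : Subgroup G) := htop ▸ Subgroup.mem_top g
  obtain ⟨c, hc, s, hs, h⟩ := Subgroup.mem_sup_of_normal_left.1 hg
  exact ⟨c, hc, s, hs, h.symm⟩

/-- Factorization in the normalizer of a `p`-subgroup. -/
theorem aux_factor_normalizer {G : Type*} [Group G] [Finite G] {p : ℕ} [hp : Fact p.Prime]
    (D : Subgroup G)
    (hN : ∀ a ∈ Subgroup.normalizer (D : Set G), (orderOf a).Coprime p → ∀ x ∈ D, Commute a x)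
    (S : Sylow p (Subgroup.normalizer (D : Set G))) (g : Subgroup.normalizer (D : Set G)) :
    ∃ c : Subgroup.normalizer (D : Set G), (∀ x ∈ D, Commute (c : G) x) ∧ ∃ s ∈ S, g = c * s := by
  let C : Subgroup (Subgroup.normalizer (D : Set G)) :=
    (Subgroup.centralizer (D : Set G)).subgroupOf (Subgroup.normalizer (D : Set G))
  have memC : ∀ c : Subgroup.normalizer (D : Set G), c ∈ C ↔ ∀ x ∈ D, Commute (c : G) x := by
    intro c
    simp only [C, Subgroup.mem_subgroupOf, Subgroup.mem_centralizer_iff]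
    exact ⟨fun h x hx => (h x hx).symm, fun h x hx => (h x hx).symm⟩
  have hCn : C.Normal := by
    constructor
    intro c hc n
    rw [memC] at hc ⊢
    intro x hx
    have h1 : (n : G)⁻¹ * x * n ∈ D := by
      have := (Subgroup.mem_normalizer_iff.1 ((Subgroup.normalizer (D : Set G)).inv_mem n.2) x).1 hx
      simpa using this
    have h2 := (hc _ h1).eq
    simp only [Subgroup.coe_mul, Subgroup.coe_inv]
    show (n : G) * c * (n : G)⁻¹ * x = x * (n * c * (n : G)⁻¹)
    calc (n : G) * c * (n : G)⁻¹ * x = n * (c * ((n : G)⁻¹ * x * n)) * (n : G)⁻¹ := by group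
      _ = _ := by rw [h2]; group
  obtain ⟨c, hc, s, hs, h⟩ := aux_factor C (fun a ha => (memC a).2
    (hN a a.2 (by rwa [Subgroup.orderOf_coe]))) S g
  exact ⟨c, (memC c).1 hc, s, hs, h⟩

theorem aux_sylow_conj {G : Type*} [Group G] [Finite G] {p : ℕ} [hp : Fact p.Prime]
    (hN : ∀ D : Subgroup G, IsPGroup p D → ∀ a ∈ Subgroup.normalizer (D : Set G),
      (orderOf a).Coprime p → ∀ x ∈ D, Commute a x) (k : ℕ) :
    ∀ P Q : Sylow p G, Nat.card G - Nat.card ((P : Subgroup G) ⊓ Q : Subgroup G) = k →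
      ∃ c : G, (∀ x ∈ (P : Subgroup G) ⊓ Q, Commute c x) ∧ c • P = Q := by
  induction k using Nat.strong_induction_on with
  | _ k ih =>
  intro P Q hk
  by_cases hPQ : (P : Subgroup G) ≤ Q
  · exact ⟨1, fun x _ => Commute.one_left x, by rw [one_smul]; exact Sylow.ext (P.3 Q.2 hPQ).symm⟩
  by_cases hQP : (Q : Subgroup G) ≤ P
  · exact ⟨1, fun x _ => Commute.one_left x, by rw [one_smul]; exact Sylow.ext (Q.3 P.2 hQP)⟩
  have hstep : ∀ P' Q' : Sylow p G, (P : Subgroup G) ⊓ Q < (P' : Subgroup G) ⊓ Q' →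
      ∃ c : G, (∀ x ∈ (P : Subgroup G) ⊓ Q, Commute c x) ∧ c • P' = Q' := by
    intro P' Q' hlt
    have h1 : Nat.card ((P : Subgroup G) ⊓ Q : Subgroup G) <
        Nat.card ((P' : Subgroup G) ⊓ Q' : Subgroup G) :=
      Set.ncard_lt_ncard hlt (Set.toFinite _)
    have h2 : Nat.card ((P' : Subgroup G) ⊓ Q' : Subgroup G) ≤ Nat.card G :=
      Subgroup.card_le_card_group _
    obtain ⟨c, hc, hc'⟩ := ih _ (by omega) P' Q' rfl
    exact ⟨c, fun x hx => hc x (hlt.le hx), hc'⟩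
  set D : Subgroup G := (P : Subgroup G) ⊓ Q with hDdef
  have hD : IsPGroup p D := P.2.to_inf_left
  have hDP : D < P := lt_of_le_of_ne inf_le_left fun h => hPQ (h ▸ inf_le_right)
  have hDQ : D < Q := lt_of_le_of_ne inf_le_right fun h => hQP (h ▸ inf_le_left)
  have hP1 := aux_normalizer P.2 hDP
  have hQ1 := aux_normalizer Q.2 hDQ
  obtain ⟨S, hS⟩ := (P.2.comap_subtype (K := Subgroup.normalizer (D : Set G))).exists_le_sylow
  obtain ⟨T, hT⟩ := (Q.2.comap_subtype (K := Subgroup.normalizer (D : Set G))).exists_le_sylow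
  obtain ⟨R, hR⟩ := (S.2.map (Subgroup.normalizer (D : Set G)).subtype).exists_le_sylow
  obtain ⟨n, hn⟩ := MulAction.exists_smul_eq (Subgroup.normalizer (D : Set G)) S T
  obtain ⟨c, hc, s, hs, hcs⟩ := aux_factor_normalizer D (hN D hD) S n
  have hcST : c • S = T := by
    rw [← hn, hcs, mul_smul]
    congr 1
    exact (Sylow.smul_eq_iff_mem_normalizer.2 (Subgroup.le_normalizer hs)).symm
  have hPR : D < (P : Subgroup G) ⊓ R := by
    refine lt_of_lt_of_le hP1 (le_inf inf_le_left ?_)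
    intro x hx
    exact hR ⟨⟨x, hx.2⟩, hS hx.1, rfl⟩
  have hRQ : D < (((c : G) • R : Sylow p G) : Subgroup G) ⊓ (Q : Subgroup G) := by
    refine lt_of_lt_of_le hQ1 (le_inf ?_ inf_le_left)
    intro x hx
    have h1 : (⟨x, hx.2⟩ : Subgroup.normalizer (D : Set G)) ∈ T := hT hx.1
    rw [← hcST] at h1
    have h2 : (⟨x, hx.2⟩ : Subgroup.normalizer (D : Set G)) ∈
      ((c • S : Sylow p _) : Subgroup (Subgroup.normalizer (D : Set G))) := h1
    rw [Sylow.coe_subgroup_smul, Subgroup.mem_pointwise_smul_iff_inv_smul_mem] at h2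
    rw [Sylow.coe_subgroup_smul, Subgroup.mem_pointwise_smul_iff_inv_smul_mem]
    have h3 := hR ⟨_, h2, rfl⟩
    simpa [← map_inv] using h3
  obtain ⟨c1, h1, h1'⟩ := hstep P R hPR
  obtain ⟨c2, h2, h2'⟩ := hstep ((c : G) • R) Q hRQ
  refine ⟨c2 * c * c1, fun x hx => ((h2 x hx).mul_left (hc x hx)).mul_left (h1 x hx), ?_⟩
  rw [mul_smul, mul_smul, h1', h2']

theorem aux_fusion {G : Type*} [Group G] [Finite G] {p : ℕ} [hp : Fact p.Prime]
    (hN : ∀ D : Subgroup G, IsPGroup p D → ∀ a ∈ Subgroup.normalizer (D : Set G),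
      (orderOf a).Coprime p → ∀ x ∈ D, Commute a x) (P : Sylow p G) (x g : G)
    (hx : x ∈ P) (hg : g * x * g⁻¹ ∈ P) : ∃ u ∈ P, u * x * u⁻¹ = g * x * g⁻¹ := by
  obtain ⟨c, hc, hcP⟩ := aux_sylow_conj hN _ (g • P) P rfl
  have hy : g * x * g⁻¹ ∈ ((g • P : Sylow p G) : Subgroup G) ⊓ P := by
    refine ⟨?_, hg⟩
    show g * x * g⁻¹ ∈ ((g • P : Sylow p G) : Subgroup G)
    rw [Sylow.coe_subgroup_smul, Subgroup.mem_pointwise_smul_iff_inv_smul_mem]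
    rw [← map_inv, MulAut.smul_def, MulAut.conj_apply]
    have hx2 : x ∈ (P : Subgroup G) := hx
    simpa [mul_assoc] using hx2
  have hcg : c * g ∈ Subgroup.normalizer ((P : Subgroup G) : Set G) := by
    rw [← mul_smul] at hcP
    exact Sylow.smul_eq_iff_mem_normalizer.1 hcP
  obtain ⟨d, hd, u, hu, hdu⟩ := aux_factor_normalizer (P : Subgroup G) (hN P P.2)
    (P.subtype Subgroup.le_normalizer) ⟨c * g, hcg⟩
  have hdu' : c * g = d * u := congrArg Subtype.val hdu
  have huP : (u : G) ∈ P := hu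
  refine ⟨u, huP, ?_⟩
  have h1 : (u : G) * x * (u : G)⁻¹ ∈ (P : Subgroup G) :=
    Subgroup.mul_mem _ (Subgroup.mul_mem _ huP hx) (Subgroup.inv_mem _ huP)
  have h2 : (d : G) * (u * x * (u : G)⁻¹) * (d : G)⁻¹ = u * x * (u : G)⁻¹ := by
    rw [(hd _ h1).eq]; group
  have h3 : c * (g * x * g⁻¹) * c⁻¹ = g * x * g⁻¹ := by
    rw [(hc _ hy).eq]; group
  rw [← h2, ← h3]
  calc (d : G) * (u * x * (u : G)⁻¹) * (d : G)⁻¹ = (d * u) * x * ((d : G) * u)⁻¹ := by group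
    _ = _ := by rw [← hdu']; group

/-- `p`-nilpotency passes up from a normal subgroup of `p`-power index. -/
theorem aux_ext {G : Type*} [Group G] [Finite G] {p : ℕ} [hp : Fact p.Prime]
    (K : Subgroup G) [hKn : K.Normal] (m : ℕ) (hm : K.index = p ^ m) (hK : IsPNilpotent p K) :
    IsPNilpotent p G := by
  obtain ⟨H, hH, ⟨n, hn⟩, hcard⟩ := hK
  have hcop : ∀ k : K, (orderOf k).Coprime p → k ∈ H := by
    intro k hk
    rw [← QuotientGroup.eq_one_iff, ← orderOf_eq_one_iff]
    refine Nat.eq_one_of_dvd_coprimes (hk.pow_right n) (orderOf_map_dvd (QuotientGroup.mk' H) k) ?_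
    rw [← hn]
    exact orderOf_dvd_natCard _
  refine ⟨H.map K.subtype, ⟨?_⟩, ⟨n + m, ?_⟩, ?_⟩
  · rintro _ ⟨h, hh, rfl⟩ g
    refine ⟨⟨g * h * g⁻¹, hKn.conj_mem h h.2 g⟩, ?_, rfl⟩
    apply hcop
    have h1 : orderOf (⟨g * h * g⁻¹, hKn.conj_mem h h.2 g⟩ : K) = orderOf h := by
      rw [Subgroup.orderOf_mk, ← Subgroup.orderOf_coe h]
      exact orderOf_injective (MulAut.conj g).toMonoidHom (MulAut.conj g).injective (h : G)
    rw [h1]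
    have h2 : orderOf h ∣ Nat.card H := Subgroup.orderOf_dvd_natCard H hh
    exact Nat.Coprime.coprime_dvd_left h2 ((Nat.Prime.coprime_iff_not_dvd hp.out).2 hcard).symm
  · rw [Subgroup.index_map_subtype, hn, hm, pow_add]
  · rwa [Subgroup.card_map_of_injective K.subtype_injective]

universe u

open scoped commutatorElement in
theorem aux_ito {p : ℕ} [hp : Fact p.Prime] (hodd : Odd p) (n : ℕ) :
    ∀ (G : Type u) [Group G] [Finite G], Nat.card G = n →
    (∀ x : G, orderOf x = p → x ∈ Subgroup.center G) → IsPNilpotent p G := by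
  induction n using Nat.strong_induction_on with
  | _ n ih =>
  intro G _ _ hn hcen
  by_cases hdvd : p ∣ Nat.card G
  swap
  · exact ⟨⊤, inferInstance, ⟨0, by simp⟩, by simpa using hdvd⟩
  have hN : ∀ D : Subgroup G, IsPGroup p D → ∀ a ∈ Subgroup.normalizer (D : Set G),
      (orderOf a).Coprime p → ∀ x ∈ D, Commute a x := by
    intro D hD a ha hco
    exact aux_coprime_s15 hodd a hco _ D rfl hD
      (fun x hx => (Subgroup.mem_normalizer_iff.1 ha x).1 hx)
      (fun x _ hxp => Subgroup.mem_center_iff.1 (hcen x hxp) a)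
  obtain ⟨P⟩ : Nonempty (Sylow p G) := inferInstance
  have hPb := P.ne_bot_of_dvd_card hdvd
  have hfoc : (P : Subgroup G).focalSubgroup ≤ ⁅(P : Subgroup G), (P : Subgroup G)⁆ := by
    rw [Subgroup.focalSubgroup_def, Subgroup.closure_le]
    rintro _ ⟨hg, x, hx, u, rfl⟩
    have h1 : u * x⁻¹ * u⁻¹ ∈ (P : Subgroup G) := by
      have := (P : Subgroup G).mul_mem ((P : Subgroup G).inv_mem hx) hg
      rw [commutatorElement_def] at this
      simpa [mul_assoc] using this
    obtain ⟨v, hv, hv'⟩ := aux_fusion hN P x⁻¹ u (P.inv_mem hx) h1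
    have h2 : ⁅x, u⁆ = ⁅x, v⁆ := by
      rw [commutatorElement_def, commutatorElement_def, mul_assoc x, mul_assoc x, mul_assoc x,
        mul_assoc x, hv']
    rw [h2]
    exact Subgroup.commutator_mem_commutator hx hv
  have hlt : (P : Subgroup G).focalSubgroup < P := by
    refine lt_of_le_of_lt hfoc ?_
    have hnil := P.2.isNilpotent
    have hnt : Nontrivial P := (Subgroup.nontrivial_iff_ne_bot _).2 hPb
    have hlt := Group.IsSolvable.commutator_lt_top_of_nontrivial P
    refine lt_of_le_of_ne (Subgroup.commutator_le_self _) ?_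
    intro h
    apply hlt.ne
    apply Subgroup.map_subtype_inj.1
    rw [Subgroup.map_subtype_commutator, h, ← MonoidHom.range_eq_map, Subgroup.range_subtype]
  let K := (P : Subgroup G).transferFocal.ker
  have hKne : K ≠ ⊤ := by
    intro h
    have h1 := Subgroup.ker_transferFocal_inf_eq_focalSubgroup P
    change K ⊓ _ = _ at h1
    rw [h, top_inf_eq] at h1
    exact hlt.ne h1.symm
  have hKi : ∃ m, K.index = p ^ m := by
    have : IsPGroup p (G ⧸ K) := (P.2.to_quotient P.focalSubgroupOf).of_equiv
      (Subgroup.transferFocal.quotientKerMulEquivQuotientFocalSubroupOf P).symm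
    exact IsPGroup.iff_card.1 this
  obtain ⟨m, hm⟩ := hKi
  refine aux_ext K m hm (ih (Nat.card K) ?_ K rfl ?_)
  · rw [← hn]
    refine lt_of_le_of_ne (Subgroup.card_le_card_group K) fun h => hKne ?_
    exact Subgroup.eq_top_of_card_eq K h
  · intro x hx
    rw [← Subgroup.orderOf_coe] at hx
    rw [Subgroup.mem_center_iff]
    intro g
    exact Subtype.ext (Subgroup.mem_center_iff.1 (hcen x hx) g)

theorem stmt15 {G : Type*} [Group G] [Finite G] (p : ℕ) (hp : p.Prime) (hodd : Odd p)
    (hdvd : p ∣ Nat.card G) (hsmall : ∀ q : ℕ, q.Prime → q ∣ Nat.card G → p ≤ q)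
    (N : Subgroup G) [N.Normal] (hquot : IsPNilpotent p (G ⧸ N))
    (hmin : ∀ x : G, x ∈ N → orderOf x = p → x ∈ Subgroup.center G) :
    IsPNilpotent p G := by
  have : Fact p.Prime := ⟨hp⟩
  obtain ⟨H, hH, ⟨n, hn⟩, hcard⟩ := hquot
  have hKn : (H.comap (QuotientGroup.mk' N)).Normal := inferInstance
  refine aux_ext (H.comap (QuotientGroup.mk' N)) n ?_ (aux_ito hodd _ _ rfl ?_)
  · rw [Subgroup.index_comap_of_surjective _ (QuotientGroup.mk'_surjective N), hn]
  · intro x hx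
    rw [← Subgroup.orderOf_coe] at hx
    have hxN : (x : G) ∈ N := by
      rw [← QuotientGroup.eq_one_iff, ← orderOf_eq_one_iff]
      have h1 : orderOf ((x : G) : G ⧸ N) ∣ p := by
        rw [← hx]; exact orderOf_map_dvd (QuotientGroup.mk' N) (x : G)
      have h2 : orderOf ((x : G) : G ⧸ N) ∣ Nat.card H := Subgroup.orderOf_dvd_natCard H x.2
      exact Nat.eq_one_of_dvd_coprimes ((Nat.Prime.coprime_iff_not_dvd hp).2 hcard) h1 h2
    rw [Subgroup.mem_center_iff]
    intro g
    exact Subtype.ext (Subgroup.mem_center_iff.1 (hmin x hxN hx) g)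
end
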